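/- arXiv:1309.6940 — 10 statements merged into one kernel-verified Lean document; each statement's English description precedes it below -/
import Mathlib

section
/- Let (S_n, ρ_n), n = 0, 1, 2, …, be separable metric spaces and for each n ≥ 1 let φ_n : S_n → S_0 be a Borel measurable map. Let μ_n be a Borel probability measure on S_n for each n ≥ 0, and suppose that the pushforward measures μ_n ∘ φ_n⁻¹ converge weakly to μ_0 as n → ∞. Then there exist a probability space (Ω, 𝓕, P) and random elements X_n : Ω → S_n for n = 0, 1, 2, … such that the law of X_n is μ_n for every n and ρ_0(φ_n(X_n), X_0) → 0 almost surely as n → ∞. -/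
open Filter MeasureTheory Topology TopologicalSpace

open scoped ENNReal

/-- A separable metric space splits into countably many small Borel cells with null boundaries;
the cells are the fibres of a measurable index function. -/
lemma exists_measurable_index_null_frontier {E : Type*} [PseudoMetricSpace E] [SeparableSpace E]
    [Nonempty E] [MeasurableSpace E] [OpensMeasurableSpace E] (μ : Measure E) [SFinite μ]
    {ε : ℝ} (hε : 0 < ε) :
    ∃ g : E → ℕ, Measurable g ∧ (∀ i, μ (frontier (g ⁻¹' {i})) = 0) ∧
      ∀ x y, g x = g y → dist x y < ε := by
  have hr (i : ℕ) : ∃ r ∈ Set.Ioo (ε / 4) (ε / 2),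
      μ (frontier (Metric.ball (denseSeq E i) r)) = 0 := by
    simpa only [Metric.thickening_singleton] using
      exists_null_frontier_thickening μ {denseSeq E i} (by linarith : ε / 4 < ε / 2)
  choose r hr hnull using hr
  set A : ℕ → Set E := fun i => Metric.ball (denseSeq E i) (r i) with hA
  have hcover : ⋃ i, disjointed A i = Set.univ := by
    rw [iUnion_disjointed, Set.eq_univ_iff_forall]
    intro x
    obtain ⟨i, hi⟩ := (denseRange_denseSeq E).exists_dist_lt x (by linarith : 0 < ε / 4)
    exact Set.mem_iUnion.2 ⟨i, Metric.mem_ball.2 (hi.trans (hr i).1)⟩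
  have hex (x : E) : ∃ i, x ∈ disjointed A i :=
    Set.mem_iUnion.1 (hcover ▸ Set.mem_univ x)
  choose g hg using hex
  have hfib (i : ℕ) : g ⁻¹' {i} = disjointed A i := by
    ext x
    refine ⟨fun h => (Set.mem_singleton_iff.1 h) ▸ hg x, fun h => ?_⟩
    by_contra hne
    exact Set.disjoint_left.1 (disjoint_disjointed A hne) (hg x) h
  refine ⟨g, measurable_to_countable' fun i => ?_, fun i => ?_, fun x y hxy => ?_⟩
  · rw [hfib]
    exact MeasurableSet.disjointed (fun i => Metric.isOpen_ball.measurableSet) i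
  · rw [hfib]
    refine disjointedRec (p := fun s => μ (frontier s) = 0) (fun t j ht => ?_) (hnull i)
    refine measure_mono_null (t := frontier t ∪ frontier (A j)) ?_
      (measure_union_null ht (hnull j))
    rw [Set.sdiff_eq, ← frontier_compl (A j)]
    exact (frontier_inter_subset _ _).trans
      (Set.union_subset_union Set.inter_subset_left Set.inter_subset_right)
  · have hx := Metric.mem_ball.1 (disjointed_subset A _ (hg x))
    have hy := Metric.mem_ball.1 (disjointed_subset A _ (hg y))
    rw [← hxy] at hy
    have := dist_triangle_right x y (denseSeq E (g x))
    linarith [(hr (g x)).2]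

/-- A probability measure is a mixture with prescribed weights, where the component `i + 1` lives on
the fibre of `g` over `i`, as soon as these weights do not exceed the masses of the fibres. -/
lemma exists_mixture_of_weight_le {T : Type*} [MeasurableSpace T] (μ : Measure T)
    [IsProbabilityMeasure μ] {g : T → ℕ} (hg : Measurable g) {w : ℕ → ℝ≥0∞}
    (hw : ∑' i, w i = 1) (hle : ∀ i, w (i + 1) ≤ μ (g ⁻¹' {i})) :
    ∃ m : ℕ → Measure T, (∀ i, IsProbabilityMeasure (m i)) ∧
      (∀ i, w (i + 1) ≠ 0 → ∀ᵐ y ∂m (i + 1), g y = i) ∧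
      Measure.sum (fun i => w i • m i) = μ := by
  have hmeas (i : ℕ) : MeasurableSet (g ⁻¹' {i}) := hg (measurableSet_singleton i)
  have hdisj : Pairwise (Function.onFun Disjoint fun i => g ⁻¹' {i}) := fun i j hij =>
    Disjoint.preimage g (by simpa using hij)
  have hun : ⋃ i, g ⁻¹' {i} = Set.univ := by ext; simp
  have hsum : Measure.sum (fun i => μ.restrict (g ⁻¹' {i})) = μ := by
    rw [← Measure.restrict_iUnion hdisj hmeas, hun, Measure.restrict_univ]
  set c : ℕ → ℝ≥0∞ := fun i => w (i + 1) / μ (g ⁻¹' {i}) with hc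
  have hc1 (i : ℕ) : c i ≤ 1 := ENNReal.div_le_of_le_mul (by simpa using hle i)
  have hcmul (i : ℕ) : c i * μ (g ⁻¹' {i}) = w (i + 1) := by
    rcases eq_or_ne (μ (g ⁻¹' {i})) 0 with h0 | h0
    · have := hle i
      simp_all
    · exact ENNReal.div_mul_cancel h0 (measure_ne_top _ _)
  set ν : Measure T := Measure.sum fun i => (1 - c i) • μ.restrict (g ⁻¹' {i}) with hν
  have hsplit : ν + Measure.sum (fun i => c i • μ.restrict (g ⁻¹' {i})) = μ := by
    rw [hν, Measure.sum_add_sum]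
    conv_rhs => rw [← hsum]
    congr 1
    ext1 i
    rw [← add_smul, tsub_add_cancel_of_le (hc1 i), one_smul]
  have hw' : w 0 + ∑' i, w (i + 1) = 1 := by
    rw [← hw]
    exact (tsum_eq_zero_add' ENNReal.summable).symm
  have hνuniv : ν Set.univ = w 0 := by
    have h := congrArg (fun η : Measure T => η Set.univ) hsplit
    simp only [Measure.add_apply, Measure.sum_apply _ MeasurableSet.univ, Measure.smul_apply,
      Measure.restrict_apply_univ, smul_eq_mul, hcmul, measure_univ] at h
    have hfin : ∑' i, w (i + 1) ≠ ∞ :=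
      ne_top_of_le_ne_top ENNReal.one_ne_top (hw' ▸ le_add_self)
    exact (ENNReal.add_left_inj hfin).1 (h.trans hw'.symm)
  classical
  refine ⟨fun
    | 0 => if w 0 = 0 then μ else (w 0)⁻¹ • ν
    | i + 1 => if w (i + 1) = 0 then μ else ProbabilityTheory.cond μ (g ⁻¹' {i}), ?_, ?_, ?_⟩
  · rintro (_ | i)
    · dsimp only
      split_ifs with h
      · infer_instance
      · refine ⟨?_⟩
        rw [Measure.smul_apply, hνuniv, smul_eq_mul]
        exact ENNReal.inv_mul_cancel h
          (ne_top_of_le_ne_top ENNReal.one_ne_top (hw' ▸ le_self_add))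
    · dsimp only
      split_ifs with h
      · infer_instance
      · exact ProbabilityTheory.cond_isProbabilityMeasure
          (ne_bot_of_le_ne_bot h (hle i))
  · intro i hi
    simp only [if_neg hi]
    exact ProbabilityTheory.ae_cond_mem (hmeas i)
  · conv_rhs => rw [← hsplit]
    ext s hs
    rw [Measure.add_apply, Measure.sum_apply _ hs, tsum_eq_zero_add' ENNReal.summable]
    congr 1
    · dsimp only
      split_ifs with h
      · rw [h, zero_smul, Measure.coe_zero, Pi.zero_apply]
        exact (measure_mono_null (Set.subset_univ s) (hνuniv.trans h)).symm
      · rw [smul_smul, ENNReal.mul_inv_cancel h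
          (ne_top_of_le_ne_top ENNReal.one_ne_top (hw' ▸ le_self_add)), one_smul]
    · rw [Measure.sum_apply _ hs]
      refine tsum_congr fun i => ?_
      dsimp only
      split_ifs with h
      · simp [hc, h]
      · rw [ProbabilityTheory.cond, smul_smul, ← div_eq_mul_inv]

/-- If, for each `k`, almost every point eventually satisfies `p k n`, then almost every point
eventually satisfies `p (κ n) n` for some sequence `κ` tending to infinity. -/
lemma exists_tendsto_atTop_ae_eventually_diagonal {α : Type*} [MeasurableSpace α] (Q : Measure α)
    [IsFiniteMeasure Q] {p : ℕ → ℕ → α → Prop} (hp : ∀ k n, MeasurableSet {a | p k n a})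
    (h : ∀ k, ∀ᵐ a ∂Q, ∀ᶠ n in atTop, p k n a) :
    ∃ κ : ℕ → ℕ, Tendsto κ atTop atTop ∧ ∀ᵐ a ∂Q, ∀ᶠ n in atTop, p (κ n) n a := by
  set D : ℕ → ℕ → Set α := fun k N => ⋃ n ≥ N, {a | p k n a}ᶜ with hD
  have hmeas (k N : ℕ) : MeasurableSet (D k N) :=
    MeasurableSet.iUnion fun n => MeasurableSet.iUnion fun _ => (hp k n).compl
  have hlim (k : ℕ) : Tendsto (fun N => Q (D k N)) atTop (𝓝 0) := by
    have h0 : Q (⋂ N, D k N) = 0 := by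
      refine measure_mono_null (fun a ha => ?_) (ae_iff.1 (h k))
      simp only [hD, Set.mem_iInter, Set.mem_iUnion, Set.mem_compl_iff, Set.mem_ofPred_eq,
        eventually_atTop, not_exists, not_forall] at ha ⊢
      exact ha
    rw [← h0]
    refine tendsto_measure_iInter_atTop (fun N => (hmeas k N).nullMeasurableSet)
      (fun M N hMN => ?_) ⟨0, measure_ne_top _ _⟩
    exact Set.biUnion_subset_biUnion_left fun n hn => le_trans hMN hn
  obtain ⟨δ, hδ, hδsum⟩ := ENNReal.exists_pos_sum_of_countable one_ne_zero ℕ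
  have hex (k : ℕ) : ∃ N, Q (D k N) < δ k :=
    ((hlim k).eventually_lt_const (by simpa using hδ k)).exists
  choose N hN using hex
  have hBC : ∀ᵐ a ∂Q, ∀ᶠ k in atTop, a ∉ D k (N k) :=
    ae_eventually_notMem (ne_top_of_le_ne_top ENNReal.one_ne_top
      ((ENNReal.tsum_le_tsum fun k => (hN k).le).trans hδsum.le))
  have hκ : Tendsto (fun n => Nat.findGreatest (fun k => N k ≤ n) n) atTop atTop := by
    refine tendsto_atTop.2 fun K => ?_
    filter_upwards [eventually_ge_atTop K, eventually_ge_atTop (N K)] with n h1 h2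
    exact Nat.le_findGreatest h1 h2
  refine ⟨_, hκ, ?_⟩
  filter_upwards [hBC] with a ha
  filter_upwards [hκ.eventually ha, hκ.eventually_gt_atTop 0] with n hn hpos
  by_contra hnot
  refine hn (Set.mem_biUnion (x := n) ?_ hnot)
  exact Nat.findGreatest_of_ne_zero (P := fun k => N k ≤ n) rfl hpos.ne'

/-- Almost every point lies in a fibre of positive measure of a countably valued map. -/
lemma ae_measure_fiber_ne_zero {α ι : Type*} [Countable ι] [MeasurableSpace α] (μ : Measure α)
    (g : α → ι) : ∀ᵐ x ∂μ, μ (g ⁻¹' {g x}) ≠ 0 := by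
  have h : ∀ᵐ x ∂μ, ∀ i, μ (g ⁻¹' {i}) = 0 → x ∉ g ⁻¹' {i} := by
    refine ae_all_iff.2 fun i => ?_
    by_cases hi : μ (g ⁻¹' {i}) = 0
    · filter_upwards [measure_eq_zero_iff_ae_notMem.1 hi] with x hx _ using hx
    · exact Eventually.of_forall fun x h => absurd h hi
  filter_upwards [h] with x hx h0 using hx _ h0 rfl

/-- At a fixed precision `ε`, each `μ n` is a mixture over a random label `sel n` defined on
`E × (0, 1)`; almost surely the label is eventually nonzero, and a nonzero label at `(x, u)`
selects a measure concentrated on points that `φ n` maps within `ε` of `x`. -/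
lemma exists_selection_mixture {E : Type*} [PseudoMetricSpace E] [SeparableSpace E]
    [MeasurableSpace E] [BorelSpace E] {T : ℕ → Type*} [∀ n, MeasurableSpace (T n)]
    {φ : ∀ n, T n → E} (hφ : ∀ n, Measurable (φ n))
    (μ₀ : Measure E) [IsProbabilityMeasure μ₀]
    (μ : ∀ n, Measure (T n)) [∀ n, IsProbabilityMeasure (μ n)]
    (hlim : ∀ A, μ₀ (frontier A) = 0 → MeasurableSet A →
      Tendsto (fun n => μ n (φ n ⁻¹' A)) atTop (𝓝 (μ₀ A)))
    {ε : ℝ} (hε : 0 < ε) :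
    ∃ (sel : ℕ → E × ℝ → ℕ) (m : ∀ n, ℕ → Measure (T n)),
      (∀ n, Measurable (sel n)) ∧ (∀ n i, IsProbabilityMeasure (m n i)) ∧
      (∀ n, Measure.sum (fun i =>
        (μ₀.prod (volume.restrict (Set.Ioo (0 : ℝ) 1))) (sel n ⁻¹' {i}) • m n i) = μ n) ∧
      (∀ᵐ e ∂μ₀.prod (volume.restrict (Set.Ioo (0 : ℝ) 1)), ∀ᶠ n in atTop, sel n e ≠ 0) ∧
      ∀ n, ∀ᵐ e ∂μ₀.prod (volume.restrict (Set.Ioo (0 : ℝ) 1)), sel n e ≠ 0 →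
        ∀ᵐ y ∂m n (sel n e), dist (φ n y) e.1 < ε := by
  have hU : IsProbabilityMeasure (volume.restrict (Set.Ioo (0 : ℝ) 1)) := ⟨by simp⟩
  have : Nonempty E := nonempty_of_isProbabilityMeasure μ₀
  obtain ⟨g, hg, hfr, hdist⟩ := exists_measurable_index_null_frontier μ₀ hε
  set Q := μ₀.prod (volume.restrict (Set.Ioo (0 : ℝ) 1)) with hQ
  set q : ℕ → ℝ := fun i => (μ₀ (g ⁻¹' {i})).toReal with hq
  set p : ℕ → ℕ → ℝ := fun n i => (μ n (φ n ⁻¹' (g ⁻¹' {i}))).toReal with hp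
  set G : ℕ → ℕ → Set (E × ℝ) := fun n i =>
    (g ⁻¹' {i}) ×ˢ {u | q i * u < p n i} with hG
  have hgm (i : ℕ) : MeasurableSet (g ⁻¹' {i}) := hg (measurableSet_singleton i)
  have hum (n i : ℕ) : MeasurableSet {u : ℝ | q i * u < p n i} :=
    measurableSet_lt (by fun_prop) (by fun_prop)
  set sel : ℕ → E × ℝ → ℕ := fun n e => if q (g e.1) * e.2 < p n (g e.1) then g e.1 + 1 else 0
    with hsel
  have hselm (n : ℕ) : Measurable (sel n) := by
    have hg1 : Measurable fun e : E × ℝ => g e.1 := hg.comp measurable_fst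
    refine Measurable.ite (measurableSet_lt ?_ ?_) ?_ measurable_const
    · exact ((measurable_of_countable q).comp hg1).mul measurable_snd
    · exact (measurable_of_countable (p n)).comp hg1
    · exact (measurable_of_countable (fun i : ℕ => i + 1)).comp hg1
  have hselsucc (n i : ℕ) : sel n ⁻¹' {i + 1} = G n i := by
    ext ⟨x, u⟩
    simp only [hsel, hG, Set.mem_preimage, Set.mem_singleton_iff, Set.mem_prod, Set.mem_ofPred_eq]
    constructor
    · intro h
      split_ifs at h with h'
      obtain rfl : g x = i := by omega
      exact ⟨rfl, h'⟩
    · rintro ⟨rfl, h⟩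
      rw [if_pos h]
  have hweight (n i : ℕ) : Q (sel n ⁻¹' {i + 1}) ≤ μ n ((g ∘ φ n) ⁻¹' {i}) := by
    rw [hselsucc, hG, hQ, Measure.prod_prod, Measure.restrict_apply (hum n i)]
    rcases eq_or_ne (μ₀ (g ⁻¹' {i})) 0 with h0 | h0
    · simp [h0]
    have hqpos : 0 < q i := ENNReal.toReal_pos h0 (measure_ne_top _ _)
    have hsub : {u : ℝ | q i * u < p n i} ∩ Set.Ioo 0 1 ⊆ Set.Ioo 0 (p n i / q i) := by
      rintro u ⟨hu, hu'⟩
      exact ⟨hu'.1, (lt_div_iff₀' hqpos).2 hu⟩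
    calc μ₀ (g ⁻¹' {i}) * volume ({u : ℝ | q i * u < p n i} ∩ Set.Ioo 0 1)
        ≤ ENNReal.ofReal (q i) * ENNReal.ofReal (p n i / q i) := by
          gcongr
          · rw [hq, ENNReal.ofReal_toReal (measure_ne_top _ _)]
          · exact (measure_mono hsub).trans (by simp)
      _ = ENNReal.ofReal (p n i) := by
          rw [← ENNReal.ofReal_mul hqpos.le, mul_div_cancel₀ _ hqpos.ne']
      _ = μ n ((g ∘ φ n) ⁻¹' {i}) := by
          rw [hp, ENNReal.ofReal_toReal (measure_ne_top _ _)]; rfl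
  have htotal (n : ℕ) : ∑' i, Q (sel n ⁻¹' {i}) = 1 := by
    have h := tsum_measure_preimage_singleton (μ := Q) (f := sel n) Set.countable_univ
      (fun i _ => hselm n (measurableSet_singleton i))
    rw [Set.preimage_univ, measure_univ] at h
    rw [← h, tsum_univ fun i => Q (sel n ⁻¹' {i})]
  have hmix (n : ℕ) := exists_mixture_of_weight_le (μ n) (hg.comp (hφ n)) (htotal n) (hweight n)
  choose m hm hmg hmsum using hmix
  refine ⟨sel, m, hselm, hm, hmsum, ?_, fun n => ?_⟩
  · have h1 : ∀ᵐ e ∂Q, μ₀ (g ⁻¹' {g e.1}) ≠ 0 := by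
      refine Measure.quasiMeasurePreserving_fst.ae (p := fun x => μ₀ (g ⁻¹' {g x}) ≠ 0) ?_
      exact ae_measure_fiber_ne_zero μ₀ g
    have h2 : ∀ᵐ e ∂Q, e.2 ∈ Set.Ioo (0 : ℝ) 1 :=
      Measure.quasiMeasurePreserving_snd.ae (ae_restrict_mem measurableSet_Ioo)
    filter_upwards [h1, h2] with e he1 he2
    have hqpos : 0 < q (g e.1) := ENNReal.toReal_pos he1 (measure_ne_top _ _)
    have hpq : Tendsto (fun n => p n (g e.1)) atTop (𝓝 (q (g e.1))) :=
      (ENNReal.tendsto_toReal (measure_ne_top _ _)).comp (hlim _ (hfr _) (hgm _))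
    filter_upwards [hpq.eventually_const_lt (mul_lt_of_lt_one_right hqpos he2.2)] with n hn
    simp [hsel, hn]
  · filter_upwards [ae_measure_fiber_ne_zero Q (sel n)] with e he hne
    have hval : sel n e = g e.1 + 1 := by
      by_contra hcon
      simp only [hsel] at hne hcon
      split_ifs at hne hcon <;> simp_all
    rw [hval] at he ⊢
    filter_upwards [hmg n _ he] with y hy
    exact hdist _ _ hy

/-- Selecting the coordinate `(j, sel e)` of an independent family realizes the mixture law. -/
lemma map_eval_selection {α ι : Type*} [MeasurableSpace α] {T : ι → Type*}
    [∀ i, MeasurableSpace (T i)] (Q : Measure α) [IsProbabilityMeasure Q]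
    (m : ∀ p : ι × ℕ, Measure (T p.1)) [∀ p, IsProbabilityMeasure (m p)]
    (j : ι) {sel : α → ℕ} (hsel : Measurable sel) :
    Measurable (β := T j) (fun ω : α × (∀ p : ι × ℕ, T p.1) => ω.2 (j, sel ω.1)) ∧
      (Q.prod (Measure.infinitePi m)).map (β := T j) (fun ω => ω.2 (j, sel ω.1)) =
        Measure.sum fun i => (Q (sel ⁻¹' {i}) • m (j, i) : Measure (T j)) := by
  have hmeas : Measurable (β := T j) (fun ω : α × (∀ p : ι × ℕ, T p.1) => ω.2 (j, sel ω.1)) := by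
    have h : Measurable (β := T j) fun z : ℕ × (∀ p : ι × ℕ, T p.1) => z.2 (j, z.1) :=
      measurable_from_prod_countable_right fun i => measurable_pi_apply (j, i)
    exact h.comp ((hsel.comp measurable_fst).prodMk measurable_snd)
  refine ⟨hmeas, ?_⟩
  ext A hA
  rw [Measure.map_apply hmeas hA, Measure.sum_apply _ hA]
  have hpre : (fun ω : α × (∀ p : ι × ℕ, T p.1) => ω.2 (j, sel ω.1)) ⁻¹' A =
      ⋃ i, (sel ⁻¹' {i}) ×ˢ ((fun y : ∀ p : ι × ℕ, T p.1 => y (j, i)) ⁻¹' A) := by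
    ext ω
    simp
  have hset (i : ℕ) : MeasurableSet ((fun y : ∀ p : ι × ℕ, T p.1 => y (j, i)) ⁻¹' A) :=
    measurable_pi_apply (j, i) hA
  rw [hpre, measure_iUnion]
  · refine tsum_congr fun i => ?_
    rw [Measure.prod_prod, Measure.smul_apply, smul_eq_mul]
    congr 1
    exact (measurePreserving_eval_infinitePi m (j, i)).measure_preimage hA.nullMeasurableSet
  · intro i i' hii'
    exact Set.disjoint_prod.2 (Or.inl (Disjoint.preimage sel (by simpa using hii')))
  · exact fun i => (hsel (measurableSet_singleton i)).prod (hset i)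

/-- Almost sure representation when the image measures converge on the Borel sets whose boundary is
null for the limit. -/
lemma exists_representation_of_tendsto_measure {E : Type} [MetricSpace E] [SeparableSpace E]
    [MeasurableSpace E] [BorelSpace E] {T : ℕ → Type} [∀ n, MeasurableSpace (T n)]
    {φ : ∀ n, T n → E} (hφ : ∀ n, Measurable (φ n))
    (μ₀ : Measure E) [IsProbabilityMeasure μ₀]
    (μ : ∀ n, Measure (T n)) [∀ n, IsProbabilityMeasure (μ n)]
    (hlim : ∀ A, μ₀ (frontier A) = 0 → MeasurableSet A →
      Tendsto (fun n => μ n (φ n ⁻¹' A)) atTop (𝓝 (μ₀ A))) :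
    ∃ (Ω : Type) (_ : MeasurableSpace Ω) (P : Measure Ω), IsProbabilityMeasure P ∧
      ∃ (X₀ : Ω → E) (X : ∀ n, Ω → T n), Measurable X₀ ∧ (∀ n, Measurable (X n)) ∧
        P.map X₀ = μ₀ ∧ (∀ n, P.map (X n) = μ n) ∧
        ∀ᵐ ω ∂P, Tendsto (fun n => dist (φ n (X n ω)) (X₀ ω)) atTop (𝓝 0) := by
  have : SecondCountableTopology E := UniformSpace.secondCountable_of_separable E
  have hU : IsProbabilityMeasure (volume.restrict (Set.Ioo (0 : ℝ) 1)) := ⟨by simp⟩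
  obtain ⟨ε, -, hεpos, hεlim⟩ := exists_seq_strictAnti_tendsto (0 : ℝ)
  choose sel m hselm hm hmsum hev hclose using fun k : ℕ =>
    exists_selection_mixture hφ μ₀ μ hlim (hεpos k)
  set Q := μ₀.prod (volume.restrict (Set.Ioo (0 : ℝ) 1)) with hQ
  obtain ⟨κ, hκ, hκev⟩ := exists_tendsto_atTop_ae_eventually_diagonal Q
    (p := fun k n e => sel k n e ≠ 0)
    (fun k n => (hselm k n (measurableSet_singleton 0)).compl) hev
  set M : ∀ p : ℕ × ℕ, Measure (T p.1) := fun p => m (κ p.1) p.1 p.2 with hM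
  have hMprob (p : ℕ × ℕ) : IsProbabilityMeasure (M p) := hm _ _ _
  have hX (n : ℕ) := map_eval_selection Q M n (hselm (κ n) n)
  refine ⟨(E × ℝ) × (∀ p : ℕ × ℕ, T p.1), inferInstance, Q.prod (Measure.infinitePi M),
    inferInstance, fun ω => ω.1.1, fun n ω => ω.2 (n, sel (κ n) n ω.1),
    measurable_fst.comp measurable_fst, fun n => (hX n).1, ?_, fun n => ?_, ?_⟩
  · exact (measurePreserving_fst.comp measurePreserving_fst).map_eq
  · rw [(hX n).2, ← hmsum (κ n) n]
  · have hnear (n : ℕ) : ∀ᵐ ω ∂Q.prod (Measure.infinitePi M), sel (κ n) n ω.1 ≠ 0 →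
        dist (φ n (ω.2 (n, sel (κ n) n ω.1))) ω.1.1 < ε (κ n) := by
      have hms : MeasurableSet {ω : (E × ℝ) × (∀ p : ℕ × ℕ, T p.1) | sel (κ n) n ω.1 ≠ 0 →
          dist (φ n (ω.2 (n, sel (κ n) n ω.1))) ω.1.1 < ε (κ n)} := by
        refine MeasurableSet.imp ?_ ?_
        · exact ((hselm (κ n) n).comp measurable_fst (measurableSet_singleton 0)).compl
        · exact measurableSet_lt (((hφ n).comp (hX n).1).dist (measurable_fst.comp measurable_fst))
            measurable_const
      refine (Measure.ae_prod_iff_ae_ae hms).2 ?_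
      filter_upwards [hclose (κ n) n] with e he
      by_cases h0 : sel (κ n) n e = 0
      · simp [h0]
      filter_upwards [(measurePreserving_eval_infinitePi M
        (n, sel (κ n) n e)).quasiMeasurePreserving.ae (he h0)] with y hy _
      exact hy
    have hev' : ∀ᵐ ω ∂Q.prod (Measure.infinitePi M), ∀ᶠ n in atTop, sel (κ n) n ω.1 ≠ 0 :=
      Measure.quasiMeasurePreserving_fst.ae hκev
    filter_upwards [ae_all_iff.2 hnear, hev'] with ω h1 h2
    refine squeeze_zero' (Eventually.of_forall fun n => dist_nonneg) ?_ (hεlim.comp hκ)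
    filter_upwards [h2] with n hn
    exact (h1 n hn).le

/-- Theorem 1.1: let `(S n, ρ n)`, `n = 0, 1, 2, …`, be separable metric
spaces, `φ n : S n → S 0` Borel measurable for `n ≥ 1`, and `μ n` Borel probability
measures on `S n` whose pushforwards `μ n ∘ φ n ⁻¹` converge weakly to `μ 0`. Then
there exist a probability space `(Ω, 𝓕, P)` and random elements `X n : Ω → S n` with
law `μ n` such that `ρ₀ (φ n (X n), X 0) → 0` almost surely. -/
theorem strong_representation_of_weak_convergence
    (S : ℕ → Type) [∀ n, MetricSpace (S n)]
    [∀ n, TopologicalSpace.SeparableSpace (S n)]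
    [∀ n, MeasurableSpace (S n)] [∀ n, BorelSpace (S n)]
    (φ : ∀ n, S n → S 0) (hφ : ∀ n, 1 ≤ n → Measurable (φ n))
    (μ : ∀ n, MeasureTheory.Measure (S n)) [∀ n, IsProbabilityMeasure (μ n)]
    (hweak : ∀ f : BoundedContinuousFunction (S 0) ℝ,
      Tendsto (fun n => ∫ x, f x ∂ ((μ n).map (φ n))) atTop
        (nhds (∫ x, f x ∂ (μ 0)))) :
    ∃ (Ω : Type) (_ : MeasurableSpace Ω) (P : MeasureTheory.Measure Ω),
      IsProbabilityMeasure P ∧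
      ∃ X : ∀ n, Ω → S n,
        (∀ n, Measurable (X n)) ∧
        (∀ n, P.map (X n) = μ n) ∧
        (∀ᵐ ω ∂P, Tendsto (fun n => dist (φ n (X n ω)) (X 0 ω)) atTop (nhds 0)) := by
  have : ∀ n, IsProbabilityMeasure ((μ (n + 1)).map (φ (n + 1))) := fun n =>
    Measure.isProbabilityMeasure_map (hφ (n + 1) n.succ_pos).aemeasurable
  have hconv : Tendsto (β := ProbabilityMeasure (S 0))
      (fun n => ⟨(μ (n + 1)).map (φ (n + 1)), this n⟩) atTop (𝓝 ⟨μ 0, inferInstance⟩) :=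
    ProbabilityMeasure.tendsto_iff_forall_integral_tendsto.2 fun f =>
      (hweak f).comp (tendsto_add_atTop_nat 1)
  have hlim (A : Set (S 0)) (hA : μ 0 (frontier A) = 0) (hAm : MeasurableSet A) :
      Tendsto (fun n => μ (n + 1) (φ (n + 1) ⁻¹' A)) atTop (𝓝 (μ 0 A)) := by
    refine (ProbabilityMeasure.tendsto_measure_of_null_frontier_of_tendsto' hconv hA).congr
      fun n => ?_
    exact Measure.map_apply (hφ (n + 1) n.succ_pos) hAm
  obtain ⟨Ω, mΩ, P, hP, X₀, X, hX₀, hX, hlaw₀, hlaw, hae⟩ :=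
    exists_representation_of_tendsto_measure (fun n => hφ (n + 1) n.succ_pos) (μ 0)
      (fun n => μ (n + 1)) hlim
  refine ⟨Ω, mΩ, P, hP, fun | 0 => X₀ | n + 1 => X n, ?_, ?_, ?_⟩
  · rintro (_ | n)
    exacts [hX₀, hX n]
  · rintro (_ | n)
    exacts [hlaw₀, hlaw n]
  · filter_upwards [hae] with ω hω
    exact (tendsto_add_atTop_iff_nat 1).1 hω
end

section
/- Let (S_n, ρ_n), n = 0, 1, 2, …, be separable metric spaces and for each n ≥ 1 let φ_n : S_n → S_0 be a continuous map. Let μ_n be a Borel probability measure on S_n for each n ≥ 0, and suppose that the pushforward measures μ_n ∘ φ_n⁻¹ converge weakly to μ_0 as n → ∞. Then there exist a probability space (Ω, 𝓕, P) and random elements X_n : Ω → S_n for n = 0, 1, 2, … such that the law of X_n is μ_n for every n and ρ_0(φ_n(X_n), X_0) → 0 almost surely as n → ∞. -/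
open Filter MeasureTheory Topology TopologicalSpace

theorem exists_nat_partition_null_frontier {S : Type*} [MetricSpace S] [SeparableSpace S]
    [MeasurableSpace S] [BorelSpace S] (μ : Measure S) [IsProbabilityMeasure μ]
    {ε : ℝ} (hε : 0 < ε) {η : ENNReal} (hη : 0 < η) :
    ∃ (g : S → ℕ) (N : ℕ), Measurable g ∧ (∀ x, g x ≤ N) ∧
      (∀ i, μ (frontier (g ⁻¹' {i})) = 0) ∧ μ (g ⁻¹' {N}) ≤ η ∧
      ∀ x y, g x = g y → g x ≠ N → dist x y < ε := by
  classical
  have : Nonempty S := nonempty_of_isProbabilityMeasure μ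
  choose r hr hr0 using fun x : S =>
    exists_null_frontier_thickening μ {x} (show ε / 4 < ε / 2 by linarith)
  simp only [Metric.thickening_singleton] at hr0
  let U : ℕ → Set S := fun k => Metric.ball (denseSeq S k) (r (denseSeq S k))
  have hcover : ∀ x, ∃ k, x ∈ U k := fun x => by
    obtain ⟨k, hk⟩ := (denseRange_denseSeq S).exists_dist_lt x
      (show 0 < ε / 4 by linarith)
    exact ⟨k, hk.trans (hr _).1⟩
  let f : S → ℕ := fun x => Nat.find (hcover x)
  have hf : Measurable f := measurable_find hcover fun k => Metric.isOpen_ball.measurableSet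
  have hsucc : ∀ i, {x | f x < i + 1} = {x | f x < i} ∪ U i := fun i => by
    ext x
    simp only [f, Nat.find_lt_iff, Set.mem_ofPred_eq, Set.mem_union]
    constructor
    · rintro ⟨m, hm, hx⟩
      rcases Nat.lt_succ_iff_lt_or_eq.1 hm with h | rfl
      exacts [Or.inl ⟨m, h, hx⟩, Or.inr hx]
    · rintro (⟨m, hm, hx⟩ | hx)
      exacts [⟨m, hm.trans (Nat.lt_succ_self i), hx⟩, ⟨i, Nat.lt_succ_self i, hx⟩]
  have hlt : ∀ i, μ (frontier {x | f x < i}) = 0 := fun i => by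
    induction i with
    | zero => simp
    | succ i ih =>
      rw [hsucc]
      refine measure_mono_null (frontier_union_subset _ _) (measure_union_null ?_ ?_)
      · exact measure_mono_null Set.inter_subset_left ih
      · exact measure_mono_null Set.inter_subset_right (hr0 _)
  have hlim : Tendsto (fun N => μ {x | N ≤ f x}) atTop (𝓝 0) := by
    have := tendsto_measure_iInter_atTop (μ := μ) (s := fun N => {x | N ≤ f x})
      (fun N => (hf measurableSet_Ici).nullMeasurableSet)
      (fun a b hab x hx => le_trans hab hx) ⟨0, measure_ne_top _ _⟩
    have hempty : ⋂ N, {x | N ≤ f x} = ∅ :=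
      Set.eq_empty_of_forall_notMem fun x hx =>
        absurd (Set.mem_iInter.1 hx (f x + 1)) (Nat.not_succ_le_self _)
    rwa [hempty, measure_empty] at this
  obtain ⟨N, hN⟩ := ((tendsto_order.1 hlim).2 η hη).exists
  refine ⟨fun x => min (f x) N, N, hf.min measurable_const, fun x => min_le_right _ _, ?_, ?_, ?_⟩
  · intro i
    rcases lt_trichotomy i N with h | rfl | h
    · have : (fun x => min (f x) N) ⁻¹' {i} = {x | f x < i + 1} ∩ {x | f x < i}ᶜ := by
        ext x; simp; omega
      rw [this]
      refine measure_mono_null (frontier_inter_subset _ _) (measure_union_null ?_ ?_)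
      · exact measure_mono_null Set.inter_subset_left (hlt _)
      · exact measure_mono_null Set.inter_subset_right (by rw [frontier_compl]; exact hlt _)
    · have : (fun x => min (f x) i) ⁻¹' {i} = {x | f x < i}ᶜ := by
        ext x; simp
      rw [this, frontier_compl]
      exact hlt _
    · have : (fun x => min (f x) N) ⁻¹' {i} = ∅ := by
        ext x; simp; omega
      simp [this]
  · refine le_trans (measure_mono fun x hx => ?_) hN.le
    simpa using hx
  · intro x y hxy hx
    have hfx : f x = f y := by simp only at hxy hx; omega
    have h1 : x ∈ U (f x) := Nat.find_spec (hcover x)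
    have h2 : y ∈ U (f x) := hfx ▸ Nat.find_spec (hcover y)
    have h3 := (hr (denseSeq S (f x))).2
    have := dist_triangle_right x y (denseSeq S (f x))
    have h1' := Metric.mem_ball.1 h1
    have h2' := Metric.mem_ball.1 h2
    linarith

theorem measurable_eval_comp {E F ι T : Type*} [MeasurableSpace E] [MeasurableSpace F]
    [Countable ι] [MeasurableSpace ι] [MeasurableSingletonClass ι] [MeasurableSpace T]
    {J : E → ι} (hJ : Measurable J) {Y : ι → F → T} (hY : ∀ j, Measurable (Y j)) :
    Measurable fun p : E × F => Y (J p.1) p.2 :=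
  (measurable_from_prod_countable_right (f := fun q : ι × F => Y q.1 q.2) hY).comp
    ((hJ.comp measurable_fst).prodMk measurable_snd)

theorem map_eval_comp_prod {E F ι T : Type*} [MeasurableSpace E] [MeasurableSpace F]
    [Countable ι] [MeasurableSpace ι] [MeasurableSingletonClass ι] [MeasurableSpace T]
    (P : Measure E) (Q : Measure F) [SFinite Q]
    {J : E → ι} (hJ : Measurable J) {Y : ι → F → T} (hY : ∀ j, Measurable (Y j)) :
    (P.prod Q).map (fun p => Y (J p.1) p.2) =
      Measure.sum fun j => P (J ⁻¹' {j}) • Q.map (Y j) := by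
  have hm := measurable_eval_comp hJ hY
  ext s hs
  rw [Measure.map_apply hm hs, Measure.prod_apply (hm hs), Measure.sum_apply _ hs]
  have : ∀ e, Q (Prod.mk e ⁻¹' ((fun p : E × F => Y (J p.1) p.2) ⁻¹' s)) =
      Q.map (Y (J e)) s := fun e => by
    rw [Measure.map_apply (hY _) hs]; rfl
  simp_rw [this]
  rw [← lintegral_map (f := fun j => Q.map (Y j) s) (Measurable.of_discrete) hJ,
    lintegral_countable']
  refine tsum_congr fun j => ?_
  rw [Measure.map_apply hJ (measurableSet_singleton j), Measure.smul_apply, smul_eq_mul, mul_comm]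

/-- A law on `T` whose fibre masses dominate the masses of a random index is a mixture, along
that index, of laws concentrated on the fibres (for nonzero values) and one further law (for `0`). -/
theorem exists_mixture_of_fiber_le {E T : Type*} [MeasurableSpace E] [MeasurableSpace T]
    (P : Measure E) [IsProbabilityMeasure P] (ρ : Measure T) [IsProbabilityMeasure ρ]
    {J : E → ℕ} (hJ : Measurable J) {h : T → ℕ} (hh : Measurable h)
    (hle : ∀ i, P (J ⁻¹' {i + 1}) ≤ ρ (h ⁻¹' {i})) :
    ∃ κ : ℕ → Measure T, (∀ j, IsProbabilityMeasure (κ j)) ∧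
      (Measure.sum fun j => P (J ⁻¹' {j}) • κ j) = ρ ∧
      ∀ i, P (J ⁻¹' {i + 1}) ≠ 0 → ∀ᵐ t ∂κ (i + 1), h t = i := by
  classical
  let κ' : ℕ → Measure T := fun i =>
    if ρ (h ⁻¹' {i}) = 0 then ρ else ProbabilityTheory.cond ρ (h ⁻¹' {i})
  have hκ' : ∀ i, IsProbabilityMeasure (κ' i) := fun i => by
    by_cases h0 : ρ (h ⁻¹' {i}) = 0
    · simp only [κ', h0, if_true]; infer_instance
    · simp only [κ', h0, if_false]; exact ProbabilityTheory.cond_isProbabilityMeasure h0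
  let σ : Measure T := Measure.sum fun i => P (J ⁻¹' {i + 1}) • κ' i
  have hle' : σ ≤ ρ := by
    have hρ : Measure.sum (fun i => ρ.restrict (h ⁻¹' {i})) = ρ := by
      rw [← Measure.restrict_iUnion, ← Set.preimage_iUnion]
      · rw [Set.iUnion_of_singleton, Set.preimage_univ, Measure.restrict_univ]
      · exact fun i j hij => Disjoint.preimage h (by simpa using hij)
      · exact fun i => hh (measurableSet_singleton i)
    rw [← hρ]
    refine Measure.le_iff.2 fun s hs => ?_
    simp only [σ, Measure.sum_apply _ hs]
    refine ENNReal.tsum_le_tsum fun i => ?_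
    by_cases h0 : ρ (h ⁻¹' {i}) = 0
    · simp [le_antisymm (h0 ▸ hle i) bot_le]
    · simp only [κ', h0, if_false, ProbabilityTheory.cond, Measure.smul_apply, smul_eq_mul]
      rw [← mul_assoc]
      refine mul_le_of_le_one_left' ?_
      calc _ ≤ ρ (h ⁻¹' {i}) * (ρ (h ⁻¹' {i}))⁻¹ := by gcongr; exact hle i
        _ ≤ 1 := ENNReal.mul_inv_le_one _
  have : IsFiniteMeasure σ := isFiniteMeasure_of_le ρ hle'
  have hsum : P (J ⁻¹' {0}) + σ Set.univ = 1 := by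
    have h1 := tsum_measure_preimage_singleton (μ := P) (f := J) Set.countable_univ
      fun j _ => hJ (measurableSet_singleton j)
    rw [tsum_univ (fun j => P (J ⁻¹' {j})), Set.preimage_univ, measure_univ,
      tsum_eq_zero_add' ENNReal.summable] at h1
    simpa [σ] using h1
  have hmass : (ρ - σ) Set.univ = P (J ⁻¹' {0}) := by
    rw [Measure.sub_apply MeasurableSet.univ hle', measure_univ, ← hsum]
    exact ENNReal.add_sub_cancel_right (measure_ne_top _ _)
  obtain ⟨κ₀, hκ₀, hκ₀'⟩ : ∃ κ₀ : Measure T, IsProbabilityMeasure κ₀ ∧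
      P (J ⁻¹' {0}) • κ₀ = ρ - σ := by
    by_cases h0 : P (J ⁻¹' {0}) = 0
    · refine ⟨ρ, inferInstance, ?_⟩
      rw [h0, zero_smul, Measure.measure_univ_eq_zero.1 (hmass.trans h0)]
    · refine ⟨(P (J ⁻¹' {0}))⁻¹ • (ρ - σ), ⟨?_⟩, ?_⟩
      · rw [Measure.smul_apply, hmass, smul_eq_mul,
          ENNReal.inv_mul_cancel h0 (measure_ne_top _ _)]
      · rw [smul_smul, ENNReal.mul_inv_cancel h0 (measure_ne_top _ _), one_smul]
  refine ⟨fun j => Nat.casesOn j κ₀ κ', ?_, ?_, ?_⟩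
  · rintro (_ | i)
    exacts [hκ₀, hκ' i]
  · rw [← Measure.sub_add_cancel_of_le hle', ← hκ₀']
    ext s hs
    simp only [Measure.sum_apply _ hs, Measure.add_apply, σ]
    rw [tsum_eq_zero_add' ENNReal.summable]
    rfl
  · intro i hi
    have h0 : ρ (h ⁻¹' {i}) ≠ 0 := fun h0 => hi (le_antisymm (h0 ▸ hle i) bot_le)
    simp only [κ', h0, if_false]
    exact ProbabilityTheory.ae_cond_mem (hh (measurableSet_singleton i))

theorem measure_Iio_lt_one {ν : Measure ℕ} [IsProbabilityMeasure ν]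
    (hν : ∀ m, ν {m} ≠ 0) (m : ℕ) : ν (Set.Iio m) < 1 := by
  rw [← not_le]
  intro h
  have h1 : ν (Set.Iio m)ᶜ = 0 :=
    (prob_compl_eq_zero_iff measurableSet_Iio).2 (le_antisymm prob_le_one h)
  exact hν m (measure_mono_null (by simp) h1)

theorem eventually_forall_mul_le {S₀ : Type*} [MetricSpace S₀] [MeasurableSpace S₀] [BorelSpace S₀]
    {T : ℕ → Type*} [∀ n, TopologicalSpace (T n)] [∀ n, MeasurableSpace (T n)]
    [∀ n, BorelSpace (T n)] {ψ : ∀ n, T n → S₀} (hψ : ∀ n, Continuous (ψ n))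
    {μ : Measure S₀} [IsProbabilityMeasure μ] {ρ : ∀ n, Measure (T n)}
    [∀ n, IsProbabilityMeasure (ρ n)]
    (hweak : ∀ f : BoundedContinuousFunction S₀ ℝ,
      Tendsto (fun n => ∫ x, f x ∂((ρ n).map (ψ n))) atTop (𝓝 (∫ x, f x ∂μ)))
    {g : S₀ → ℕ} (hg : Measurable g) {N : ℕ} (hgN : ∀ x, g x ≤ N)
    (hfr : ∀ i, μ (frontier (g ⁻¹' {i})) = 0) {c : ENNReal} (hc : c < 1) :
    ∀ᶠ n in atTop, ∀ i, μ (g ⁻¹' {i}) * c ≤ ρ n ((fun t => g (ψ n t)) ⁻¹' {i}) := by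
  have hprob : ∀ n, IsProbabilityMeasure ((ρ n).map (ψ n)) := fun n =>
    Measure.isProbabilityMeasure_map (hψ n).aemeasurable
  let μ' : ProbabilityMeasure S₀ := ⟨μ, inferInstance⟩
  let ρ' : ℕ → ProbabilityMeasure S₀ := fun n => ⟨(ρ n).map (ψ n), hprob n⟩
  have hlim : Tendsto ρ' atTop (𝓝 μ') :=
    ProbabilityMeasure.tendsto_iff_forall_integral_tendsto.2 hweak
  have hi : ∀ i, ∀ᶠ n in atTop, μ (g ⁻¹' {i}) * c ≤ ρ n ((fun t => g (ψ n t)) ⁻¹' {i}) := by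
    intro i
    by_cases h0 : μ (g ⁻¹' {i}) = 0
    · simp [h0]
    have hlt : μ (g ⁻¹' {i}) * c < μ (g ⁻¹' {i}) := by
      simpa using ENNReal.mul_lt_mul_right h0 (measure_ne_top μ _) hc
    have := ProbabilityMeasure.tendsto_measure_of_null_frontier_of_tendsto' hlim (hfr i)
    filter_upwards [(tendsto_order.1 this).1 _ hlt] with n hn
    refine hn.le.trans_eq ?_
    exact Measure.map_apply (hψ n).measurable (hg (measurableSet_singleton i))
  filter_upwards [(Finset.range (N + 1)).eventually_all.2 fun i _ => hi i] with n hn i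
  by_cases h : i < N + 1
  · exact hn i (Finset.mem_range.2 h)
  · have : g ⁻¹' {i} = ∅ := Set.eq_empty_of_forall_notMem fun x hx => by
      have := hgN x
      simp only [Set.mem_preimage, Set.mem_singleton_iff] at hx
      omega
    simp [this]

/-- Theorem 1.1, continuous case: let `(S n, ρ n)`, `n = 0, 1, 2, …`, be separable metric
spaces, `φ n : S n → S 0` continuous for `n ≥ 1`, and `μ n` Borel probability
measures on `S n` whose pushforwards `μ n ∘ φ n ⁻¹` converge weakly to `μ 0`. Then
there exist a probability space `(Ω, 𝓕, P)` and random elements `X n : Ω → S n` with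
law `μ n` such that `ρ₀ (φ n (X n), X 0) → 0` almost surely. -/
theorem strong_representation_of_weak_convergence_continuous
    (S : ℕ → Type) [∀ n, MetricSpace (S n)]
    [∀ n, TopologicalSpace.SeparableSpace (S n)]
    [∀ n, MeasurableSpace (S n)] [∀ n, BorelSpace (S n)]
    (φ : ∀ n, S n → S 0) (hφ : ∀ n, 1 ≤ n → Continuous (φ n))
    (μ : ∀ n, MeasureTheory.Measure (S n)) [∀ n, IsProbabilityMeasure (μ n)]
    (hweak : ∀ f : BoundedContinuousFunction (S 0) ℝ,
      Tendsto (fun n => ∫ x, f x ∂ ((μ n).map (φ n))) atTop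
        (nhds (∫ x, f x ∂ (μ 0)))) :
    ∃ (Ω : Type) (_ : MeasurableSpace Ω) (P : MeasureTheory.Measure Ω),
      IsProbabilityMeasure P ∧
      ∃ X : ∀ n, Ω → S n,
        (∀ n, Measurable (X n)) ∧
        (∀ n, P.map (X n) = μ n) ∧
        (∀ᵐ ω ∂P, Tendsto (fun n => dist (φ n (X n ω)) (X 0 ω)) atTop (nhds 0)) := by
  classical
  have hψ : ∀ n, Continuous (φ (n + 1)) := fun n => hφ _ (Nat.le_add_left 1 n)
  let ν : Measure ℕ := ProbabilityTheory.poissonMeasure 1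
  have hν : ∀ m, ν {m} ≠ 0 := fun m h0 =>
    (ProbabilityTheory.poissonMeasure_real_singleton_pos (r := 1) m one_pos).ne'
      (by rw [measureReal_def]; exact (congrArg ENNReal.toReal h0).trans ENNReal.toReal_zero)
  choose g N hg hgN hfr hrem hdist using fun m : ℕ =>
    exists_nat_partition_null_frontier (μ 0) (Nat.one_div_pos_of_nat (α := ℝ) (n := m))
      (show (0 : ENNReal) < 2⁻¹ ^ m from ENNReal.pow_pos (by simp) m)
  let C : ℕ → ℕ → Prop := fun m n => ∀ i,
    μ 0 (g m ⁻¹' {i}) * ν (Set.Iio m) ≤ μ (n + 1) ((fun t => g m (φ (n + 1) t)) ⁻¹' {i})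
  have hC0 : ∀ n, C 0 n := fun n i => by simp
  have hC : ∀ m, ∀ᶠ n in atTop, C m n := fun m =>
    eventually_forall_mul_le hψ (fun f => (hweak f).comp (tendsto_add_atTop_nat 1))
      (hg m) (hgN m) (hfr m) (measure_Iio_lt_one hν m)
  let k : ℕ → ℕ := fun n => Nat.findGreatest (fun m => C m n) n
  have hk : ∀ n, C (k n) n := fun n =>
    Nat.findGreatest_spec (P := fun m => C m n) (Nat.zero_le n) (hC0 n)
  have hk_lim : Tendsto k atTop atTop := tendsto_atTop.2 fun m => by
    filter_upwards [hC m, eventually_ge_atTop m] with n h1 h2 using Nat.le_findGreatest h2 h1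
  let J : ℕ → S 0 × ℕ → ℕ := fun n e => if e.2 < k n then g (k n) e.1 + 1 else 0
  have hJ : ∀ n, Measurable (J n) := fun n =>
    Measurable.ite (measurable_snd measurableSet_Iio)
      (((hg _).comp measurable_fst).add_const 1) measurable_const
  have hJ_pre : ∀ n i, J n ⁻¹' {i + 1} = (g (k n) ⁻¹' {i}) ×ˢ Set.Iio (k n) := fun n i => by
    ext e
    by_cases h : e.2 < k n <;> simp [J, h]
  have hJ_mass : ∀ n i, ((μ 0).prod ν) (J n ⁻¹' {i + 1}) =
      μ 0 (g (k n) ⁻¹' {i}) * ν (Set.Iio (k n)) := fun n i => by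
    rw [hJ_pre, Measure.prod_prod]
  choose κ hκ hκ_sum hκ_ae using fun n =>
    exists_mixture_of_fiber_le ((μ 0).prod ν) (μ (n + 1)) (hJ n)
      ((hg (k n)).comp (hψ n).measurable) (fun i => (hJ_mass n i).trans_le (hk n i))
  let Q : Measure (∀ p : ℕ × ℕ, S (p.1 + 1)) := Measure.infinitePi fun p => κ p.1 p.2
  let Y : ∀ n, ℕ → (∀ p : ℕ × ℕ, S (p.1 + 1)) → S (n + 1) := fun n j y => y (n, j)
  have hY : ∀ n j, Measurable (Y n j) := fun n j => measurable_pi_apply (n, j)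
  have hQ : ∀ n j, Q.map (Y n j) = κ n j := fun n j =>
    Measure.infinitePi_map_eval (μ := fun p : ℕ × ℕ => κ p.1 p.2) (n, j)
  let P : Measure ((S 0 × ℕ) × (∀ p : ℕ × ℕ, S (p.1 + 1))) := ((μ 0).prod ν).prod Q
  let X : ∀ n, ((S 0 × ℕ) × (∀ p : ℕ × ℕ, S (p.1 + 1))) → S n := fun n =>
    match n with
    | 0 => fun ω => ω.1.1
    | n + 1 => fun ω => Y n (J n ω.1) ω.2
  refine ⟨_, inferInstance, P, inferInstance, X, ?_, ?_, ?_⟩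
  · rintro (_ | n)
    · exact measurable_fst.comp measurable_fst
    · exact measurable_eval_comp (hJ n) (hY n)
  · rintro (_ | n)
    · change P.map (Prod.fst ∘ Prod.fst) = μ 0
      rw [← Measure.map_map measurable_fst measurable_fst]
      simp [P]
    · refine (map_eval_comp_prod ((μ 0).prod ν) Q (hJ n) (hY n)).trans ?_
      simp_rw [hQ]
      exact hκ_sum n
  · have hx : ∀ᵐ x ∂μ 0, ∀ᶠ m in atTop, g m x ≠ N m := by
      refine ae_eventually_notMem (s := fun m => g m ⁻¹' {N m})
        (ne_top_of_le_ne_top ?_ (ENNReal.tsum_le_tsum hrem))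
      rw [ENNReal.tsum_geometric]
      simp
    have hx' : ∀ᵐ x ∂μ 0, ∀ m, μ 0 (g m ⁻¹' {g m x}) ≠ 0 :=
      ae_all_iff.2 fun m => by
        have : ∀ᵐ x ∂μ 0, ∀ i, μ 0 (g m ⁻¹' {i}) = 0 → g m x ≠ i :=
          ae_all_iff.2 fun i => by
            by_cases h0 : μ 0 (g m ⁻¹' {i}) = 0
            · filter_upwards [measure_eq_zero_iff_ae_notMem.1 h0] with x hx _ using hx
            · simp [h0]
        filter_upwards [this] with x hx h0 using hx _ h0 rfl
    have hy : ∀ᵐ y ∂Q, ∀ n i, ((μ 0).prod ν) (J n ⁻¹' {i + 1}) ≠ 0 →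
        g (k n) (φ (n + 1) (Y n (i + 1) y)) = i :=
      ae_all_iff.2 fun n => ae_all_iff.2 fun i => by
        by_cases h0 : ((μ 0).prod ν) (J n ⁻¹' {i + 1}) = 0
        · simp [h0]
        · have := hκ_ae n i h0
          rw [← hQ] at this
          filter_upwards [ae_of_ae_map (hY n _).aemeasurable this] with y hy _ using hy
    have hfst : Measure.QuasiMeasurePreserving (fun ω => ω.1.1) P (μ 0) :=
      Measure.quasiMeasurePreserving_fst.comp Measure.quasiMeasurePreserving_fst
    filter_upwards [hfst.ae hx, hfst.ae hx',
      (Measure.quasiMeasurePreserving_snd (μ := (μ 0).prod ν)).ae hy] with ω h1 h2 h3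
    rw [← tendsto_add_atTop_iff_nat 1]
    refine squeeze_zero' (Eventually.of_forall fun _ => dist_nonneg) ?_
      (tendsto_one_div_add_atTop_nhds_zero_nat.comp hk_lim)
    filter_upwards [hk_lim.eventually h1, hk_lim.eventually_gt_atTop ω.1.2] with n hn hlt
    have hJn : J n ω.1 = g (k n) ω.1.1 + 1 := if_pos hlt
    have hmass : ((μ 0).prod ν) (J n ⁻¹' {g (k n) ω.1.1 + 1}) ≠ 0 := by
      rw [hJ_mass]
      refine mul_ne_zero (h2 _) fun h0 => hν ω.1.2 (measure_mono_null ?_ h0)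
      simpa using hlt
    have hX : X (n + 1) ω = Y n (g (k n) ω.1.1 + 1) ω.2 := by rw [← hJn]
    have hgX := h3 n _ hmass
    rw [← hX] at hgX
    exact (hdist (k n) _ _ hgX (by rwa [hgX])).le
end

section
/- The function δ is a metric on T: it is nonnegative, symmetric, vanishes exactly on the diagonal, and satisfies the triangle inequality δ(x, z) ≤ δ(x, y) + δ(y, z) for all x, y, z ∈ T. -/
open Filter MeasureTheory Topology TopologicalSpace

/-- Within-fiber distance on the disjoint union `T = Σ n, S n`:
equals `ρ_{s(x)}(x, y)` when `s(x) = s(y)`, and `0` otherwise (unused case). -/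
noncomputable def fiberDist {S : ℕ → Type*} [∀ n, MetricSpace (S n)]
    (x y : Σ n, S n) : ℝ :=
  if h : x.1 = y.1 then dist (h ▸ x.2) y.2 else 0

/-- The metric `δ` on the disjoint union `T = Σ n, S n`:
`δ(x,y) = ρ₀(φ(x), φ(y)) + (min (ε_{s x}) (ρ_{s x}(x,y))` if `s x = s y`,
`else max (ε_{s x}) (ε_{s y}))`. -/
noncomputable def tdelta {S : ℕ → Type*} [∀ n, MetricSpace (S n)]
    (φ : ∀ n, S n → S 0) (ε : ℕ → ℝ) (x y : Σ n, S n) : ℝ :=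
  dist (φ x.1 x.2) (φ y.1 y.2) +
    (if x.1 = y.1 then min (ε x.1) (fiberDist x y) else max (ε x.1) (ε y.1))

@[simp]
theorem tdelta_mk_self {S : ℕ → Type*} [∀ n, MetricSpace (S n)]
    (φ : ∀ n, S n → S 0) (ε : ℕ → ℝ) (n : ℕ) (a b : S n) :
    tdelta φ ε ⟨n, a⟩ ⟨n, b⟩ = dist (φ n a) (φ n b) + min (ε n) (dist a b) := by
  simp [tdelta, fiberDist]

theorem tdelta_mk_of_ne {S : ℕ → Type*} [∀ n, MetricSpace (S n)]
    (φ : ∀ n, S n → S 0) (ε : ℕ → ℝ) {m n : ℕ} (h : m ≠ n) (a : S m) (b : S n) :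
    tdelta φ ε ⟨m, a⟩ ⟨n, b⟩ = dist (φ m a) (φ n b) + max (ε m) (ε n) := by
  simp [tdelta, h]

/-- `δ` is a metric on `T`: nonnegative, symmetric, vanishes exactly on
the diagonal, and satisfies the triangle inequality. -/
theorem tdelta_isMetric
    (S : ℕ → Type*) [∀ n, MetricSpace (S n)]
    (φ : ∀ n, S n → S 0) (hφ0 : φ 0 = id)
    (ε : ℕ → ℝ) (hε0 : ε 0 = 0) (hεpos : ∀ n, 1 ≤ n → 0 < ε n)
    (hεanti : StrictAntiOn ε (Set.Ici 1))
    (hεlim : Tendsto ε atTop (nhds 0)) :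
    (∀ x y : Σ n, S n, 0 ≤ tdelta φ ε x y) ∧
    (∀ x y : Σ n, S n, tdelta φ ε x y = tdelta φ ε y x) ∧
    (∀ x y : Σ n, S n, tdelta φ ε x y = 0 ↔ x = y) ∧
    (∀ x y z : Σ n, S n, tdelta φ ε x z ≤ tdelta φ ε x y + tdelta φ ε y z) := by
  have hε (n : ℕ) : 0 ≤ ε n := by
    rcases n.eq_zero_or_pos with rfl | h
    exacts [hε0.ge, (hεpos n h).le]
  refine ⟨?_, ?_, ?_, ?_⟩
  · rintro ⟨m, a⟩ ⟨n, b⟩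
    by_cases h : m = n
    · subst h
      rw [tdelta_mk_self]
      exact add_nonneg dist_nonneg (le_min (hε m) dist_nonneg)
    · rw [tdelta_mk_of_ne φ ε h]
      exact add_nonneg dist_nonneg ((hε m).trans (le_max_left _ _))
  · rintro ⟨m, a⟩ ⟨n, b⟩
    by_cases h : m = n
    · subst h
      rw [tdelta_mk_self, tdelta_mk_self, dist_comm, dist_comm a b]
    · rw [tdelta_mk_of_ne φ ε h, tdelta_mk_of_ne φ ε (Ne.symm h), dist_comm, max_comm]
  · rintro ⟨m, a⟩ ⟨n, b⟩
    by_cases h : m = n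
    · subst h
      rw [tdelta_mk_self]
      constructor
      · intro hd
        rw [add_eq_zero_iff_of_nonneg dist_nonneg (le_min (hε m) dist_nonneg)] at hd
        obtain ⟨hd₀, hd₁⟩ := hd
        suffices hab : a = b by rw [hab]
        rcases m.eq_zero_or_pos with rfl | hm
        · simpa [hφ0] using hd₀
        · by_contra hab
          exact (lt_min (hεpos m hm) (dist_pos.2 hab)).ne' hd₁
      · intro hab
        obtain rfl : a = b := by simpa using hab
        simp [hε m]
    · rw [tdelta_mk_of_ne φ ε h]
      have hmax : 0 < max (ε m) (ε n) := by
        rcases m.eq_zero_or_pos with rfl | hm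
        · exact lt_max_of_lt_right (hεpos n (Nat.pos_of_ne_zero (Ne.symm h)))
        · exact lt_max_of_lt_left (hεpos m hm)
      refine iff_of_false (add_pos_of_nonneg_of_pos dist_nonneg hmax).ne' ?_
      exact fun hab => h (congrArg Sigma.fst hab)
  · rintro ⟨l, a⟩ ⟨m, b⟩ ⟨n, c⟩
    have hφ := dist_triangle (φ l a) (φ m b) (φ n c)
    have hl := hε l
    have hm := hε m
    have hn := hε n
    by_cases hlm : l = m
    · subst hlm
      have hab : 0 ≤ dist a b := dist_nonneg
      by_cases hln : l = n
      · subst hln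
        have hbc : 0 ≤ dist b c := dist_nonneg
        have habc := dist_triangle a b c
        simp only [tdelta_mk_self]
        grind
      · rw [tdelta_mk_self, tdelta_mk_of_ne φ ε hln, tdelta_mk_of_ne φ ε hln]
        grind
    · by_cases hmn : m = n
      · subst hmn
        have hbc : 0 ≤ dist b c := dist_nonneg
        rw [tdelta_mk_self, tdelta_mk_of_ne φ ε hlm, tdelta_mk_of_ne φ ε hlm]
        grind
      · rw [tdelta_mk_of_ne φ ε hlm, tdelta_mk_of_ne φ ε hmn]
        by_cases hln : l = n
        · subst hln
          rw [tdelta_mk_self]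
          grind
        · rw [tdelta_mk_of_ne φ ε hln]
          grind
end

section
/- If every (S_n, ρ_n) is separable and every φ_n (n ≥ 1) is continuous, then the metric space (T, δ) is separable. -/
open Filter MeasureTheory Topology TopologicalSpace

/-- if every `(S n, ρ n)` is separable and every `φ n` (`n ≥ 1`) is
continuous, then the metric space `(T, δ)` is separable, i.e. there is a countable
`δ`-dense subset of `T`. -/
theorem tdelta_separable
    (S : ℕ → Type*) [∀ n, MetricSpace (S n)]
    [∀ n, TopologicalSpace.SeparableSpace (S n)]
    (φ : ∀ n, S n → S 0) (hφ0 : φ 0 = id)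
    (hφc : ∀ n, 1 ≤ n → Continuous (φ n))
    (ε : ℕ → ℝ) (hε0 : ε 0 = 0) (hεpos : ∀ n, 1 ≤ n → 0 < ε n)
    (hεanti : StrictAntiOn ε (Set.Ici 1))
    (hεlim : Tendsto ε atTop (nhds 0)) :
    ∃ D : Set (Σ n, S n), D.Countable ∧
      ∀ x : Σ n, S n, ∀ r : ℝ, 0 < r → ∃ y ∈ D, tdelta φ ε x y < r := by
  choose D hDc hDd using fun n => TopologicalSpace.exists_countable_dense (S n)
  have hc : ∀ n, Continuous (φ n) := by
    intro n
    rcases Nat.eq_zero_or_pos n with rfl | hn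
    · rw [hφ0]
      exact continuous_id
    · exact hφc n hn
  refine ⟨⋃ n, Sigma.mk n '' D n, Set.countable_iUnion fun n => (hDc n).image _, ?_⟩
  rintro ⟨n, x⟩ r hr
  have hlim : Tendsto (fun y => dist (φ n x) (φ n y) + dist x y) (𝓝 x) (𝓝 0) := by
    have h : Continuous fun y => dist (φ n x) (φ n y) + dist x y :=
      (continuous_const.dist (hc n)).add (continuous_const.dist continuous_id)
    simpa using h.tendsto x
  obtain ⟨y, hyr, hyD⟩ := mem_closure_iff_nhds.1 (hDd n x) _ (hlim.eventually_lt_const hr)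
  refine ⟨⟨n, y⟩, Set.mem_iUnion.2 ⟨n, y, hyD, rfl⟩, lt_of_le_of_lt ?_ hyr⟩
  simp [tdelta, fiberDist]
end

section
/- Suppose every φ_n (n ≥ 1) is continuous. Then for each n ≥ 1, the canonical inclusion of (S_n, ρ_n) into (T, δ) is a topological embedding with open image; that is, S_n is an open subset of (T, δ) and the subspace topology induced by δ on S_n coincides with the topology of ρ_n. -/
open Filter MeasureTheory Topology TopologicalSpace

theorem tdelta_mk_mk_same {S : ℕ → Type*} [∀ n, MetricSpace (S n)]
    (φ : ∀ n, S n → S 0) (ε : ℕ → ℝ) (n : ℕ) (x y : S n) :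
    tdelta φ ε ⟨n, x⟩ ⟨n, y⟩ = dist (φ n x) (φ n y) + min (ε n) (dist x y) := by
  simp [tdelta, fiberDist]

theorem le_tdelta_of_fst_ne {S : ℕ → Type*} [∀ n, MetricSpace (S n)]
    (φ : ∀ n, S n → S 0) (ε : ℕ → ℝ) {x y : Σ n, S n} (h : x.1 ≠ y.1) :
    ε x.1 ≤ tdelta φ ε x y := by
  rw [tdelta, if_neg h]
  exact (le_max_left _ _).trans (le_add_of_nonneg_left dist_nonneg)

/-- if every `φ n` (`n ≥ 1`) is continuous, then for each `n ≥ 1` the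
canonical inclusion of `(S n, ρ n)` into `(T, δ)` is a topological embedding with open
image: the copy of `S n` inside `T` is `δ`-open, and the `δ`-topology and the
`ρ n`-topology agree on `S n` (mutual continuity of the identity, stated with balls). -/
theorem tdelta_inclusion_embedding
    (S : ℕ → Type*) [∀ n, MetricSpace (S n)]
    (φ : ∀ n, S n → S 0) (hφ0 : φ 0 = id)
    (hφc : ∀ n, 1 ≤ n → Continuous (φ n))
    (ε : ℕ → ℝ) (hε0 : ε 0 = 0) (hεpos : ∀ n, 1 ≤ n → 0 < ε n)
    (hεanti : StrictAntiOn ε (Set.Ici 1))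
    (hεlim : Tendsto ε atTop (nhds 0)) :
    ∀ n, 1 ≤ n →
      -- the image of `S n` in `T` is `δ`-open
      ((∀ x : S n, ∃ r : ℝ, 0 < r ∧
          ∀ y : Σ m, S m, tdelta φ ε ⟨n, x⟩ y < r → y.1 = n) ∧
      -- the inclusion `(S n, ρ n) → (T, δ)` is continuous
      (∀ x : S n, ∀ r : ℝ, 0 < r → ∃ r' : ℝ, 0 < r' ∧
          ∀ y : S n, dist x y < r' → tdelta φ ε ⟨n, x⟩ ⟨n, y⟩ < r) ∧
      -- the inverse of the inclusion is continuous on the image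
      (∀ x : S n, ∀ r : ℝ, 0 < r → ∃ r' : ℝ, 0 < r' ∧
          ∀ y : S n, tdelta φ ε ⟨n, x⟩ ⟨n, y⟩ < r' → dist x y < r)) := by
  intro n hn
  refine ⟨fun x => ⟨ε n, hεpos n hn, fun y hy => ?_⟩, fun x r hr => ?_, fun x r hr => ?_⟩
  · by_contra hne
    exact hy.not_ge (le_tdelta_of_fst_ne φ ε (x := ⟨n, x⟩) (Ne.symm hne))
  · obtain ⟨d, hd, hball⟩ :=
      Metric.continuous_iff'.1 (hφc n hn) x (r / 2) (half_pos hr) |> Metric.eventually_nhds_iff.1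
    refine ⟨min d (r / 2), lt_min hd (half_pos hr), fun y hy => ?_⟩
    rw [tdelta_mk_mk_same, dist_comm (φ n x)]
    have h₁ := hball (y := y) (by rw [dist_comm]; exact hy.trans_le (min_le_left _ _))
    have h₂ := hy.trans_le (min_le_right _ _)
    linarith [min_le_right (ε n) (dist x y)]
  · refine ⟨min (ε n) r, lt_min (hεpos n hn) hr, fun y hy => ?_⟩
    rw [tdelta_mk_mk_same] at hy
    have hmin : min (ε n) (dist x y) < min (ε n) r :=
      (le_add_of_nonneg_left dist_nonneg).trans_lt hy
    exact lt_of_not_ge fun h => hmin.not_ge (min_le_min_left _ h)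
end

section
/- Fix n ≥ 1 and suppose φ_n is continuous with respect to ρ_n. If x ∈ S_n is an interior point of a subset B of the metric space (T, δ), then x is an interior point of B ∩ S_n in the metric space (S_n, ρ_n). -/
open Filter MeasureTheory Topology TopologicalSpace

theorem tdelta_mk_mk_le {S : ℕ → Type*} [∀ n, MetricSpace (S n)]
    (φ : ∀ n, S n → S 0) (ε : ℕ → ℝ) {n : ℕ} (x y : S n) :
    tdelta φ ε ⟨n, x⟩ ⟨n, y⟩ ≤ dist (φ n x) (φ n y) + dist x y := by
  simp [tdelta, fiberDist]

/-- Lemma 3.1: fix `n ≥ 1` with `φ n` continuous. If `x ∈ S n` is an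
interior point of a subset `B` of `(T, δ)`, then `x` is an interior point of
`B ∩ S n` in `(S n, ρ n)`. -/
theorem interior_point_of_tdelta_interior
    (S : ℕ → Type*) [∀ n, MetricSpace (S n)]
    (φ : ∀ n, S n → S 0) (hφ0 : φ 0 = id)
    (ε : ℕ → ℝ) (hε0 : ε 0 = 0) (hεpos : ∀ n, 1 ≤ n → 0 < ε n)
    (hεanti : StrictAntiOn ε (Set.Ici 1))
    (hεlim : Tendsto ε atTop (nhds 0))
    (n : ℕ) (hn : 1 ≤ n) (hφc : Continuous (φ n))
    (B : Set (Σ m, S m)) (x : S n)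
    (hx : ∃ r : ℝ, 0 < r ∧ ∀ y : Σ m, S m, tdelta φ ε ⟨n, x⟩ y < r → y ∈ B) :
    ∃ r : ℝ, 0 < r ∧ ∀ y : S n, dist x y < r → (⟨n, y⟩ : Σ m, S m) ∈ B := by
  obtain ⟨r, hr, hB⟩ := hx
  obtain ⟨d, hd, hφd⟩ := Metric.continuous_iff.mp hφc x (r / 2) (half_pos hr)
  refine ⟨min d (r / 2), lt_min hd (half_pos hr), fun y hy => hB _ ?_⟩
  have hφy := hφd y (by rw [dist_comm]; exact hy.trans_le (min_le_left _ _))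
  rw [dist_comm] at hφy
  linarith [tdelta_mk_mk_le φ ε x y, min_le_right d (r / 2)]
end

section
/- Let (x_m)_{m≥1} be a sequence in T and x_0 ∈ S_k for some fixed k ≥ 1. If δ(x_m, x_0) → 0 as m → ∞, then for all sufficiently large m one has s(x_m) = k (i.e., x_m ∈ S_k), and ρ_k(x_m, x_0) → 0. -/
open Filter MeasureTheory Topology TopologicalSpace

/-- The within-fiber distance is nonnegative. -/
lemma fiberDist_nonneg {S : ℕ → Type*} [∀ n, MetricSpace (S n)] (x y : Σ n, S n) :
    0 ≤ fiberDist x y := by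
  unfold fiberDist
  split_ifs
  exacts [dist_nonneg, le_rfl]

/-- Points closer than `ε (s y)` to `y` lie in the fiber of `y`, where `tdelta` bounds the
within-fiber distance. -/
lemma fst_eq_and_fiberDist_le_of_tdelta_lt {S : ℕ → Type*} [∀ n, MetricSpace (S n)]
    {φ : ∀ n, S n → S 0} {ε : ℕ → ℝ} {x y : Σ n, S n} (h : tdelta φ ε x y < ε y.1) :
    x.1 = y.1 ∧ fiberDist x y ≤ tdelta φ ε x y := by
  have hd : 0 ≤ dist (φ x.1 x.2) (φ y.1 y.2) := dist_nonneg
  unfold tdelta at h ⊢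
  split_ifs at h ⊢ with hxy
  · refine ⟨hxy, ?_⟩
    have he : ε x.1 = ε y.1 := congrArg ε hxy
    rcases min_choice (ε x.1) (fiberDist x y) with hm | hm <;> rw [hm] at h ⊢ <;> linarith
  · linarith [le_max_right (ε x.1) (ε y.1)]

/-- Lemma 3.3, first part: if `x_m → x₀` in `(T, δ)` and `x₀ ∈ S k`
for a fixed `k ≥ 1`, then eventually `s (x_m) = k` and `ρ_k (x_m, x₀) → 0`. -/
theorem tdelta_tendsto_fixed_fiber
    (S : ℕ → Type*) [∀ n, MetricSpace (S n)]
    (φ : ∀ n, S n → S 0) (hφ0 : φ 0 = id)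
    (ε : ℕ → ℝ) (hε0 : ε 0 = 0) (hεpos : ∀ n, 1 ≤ n → 0 < ε n)
    (hεanti : StrictAntiOn ε (Set.Ici 1))
    (hεlim : Tendsto ε atTop (nhds 0))
    (k : ℕ) (hk : 1 ≤ k) (x : ℕ → Σ n, S n) (x0 : S k)
    (hconv : Tendsto (fun m => tdelta φ ε (x m) ⟨k, x0⟩) atTop (nhds 0)) :
    (∀ᶠ m in atTop, (x m).1 = k) ∧
      Tendsto (fun m => fiberDist (x m) (⟨k, x0⟩ : Σ n, S n)) atTop (nhds 0) := by
  have hev : ∀ᶠ m in atTop, tdelta φ ε (x m) ⟨k, x0⟩ < ε k :=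
    hconv.eventually_lt_const (hεpos k hk)
  have key := hev.mono fun m hm =>
    fst_eq_and_fiberDist_le_of_tdelta_lt (y := (⟨k, x0⟩ : Σ n, S n)) hm
  exact ⟨key.mono fun m hm => hm.1,
    squeeze_zero' (.of_forall fun m => fiberDist_nonneg _ _) (key.mono fun m hm => hm.2) hconv⟩
end

section
/- Suppose every (S_n, ρ_n) is separable, every φ_n (n ≥ 1) is continuous, μ_n is a Borel probability measure on S_n for each n ≥ 0, and the pushforwards μ_n ∘ φ_n⁻¹ converge weakly to μ_0. Then for every open subset B of (T, δ), liminf_{n→∞} μ_n(B ∩ S_n) ≥ μ_0(B ∩ S_0). -/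
open Filter MeasureTheory Topology TopologicalSpace

theorem tdelta_zero_of_one_le {S : ℕ → Type*} [∀ n, MetricSpace (S n)]
    (φ : ∀ n, S n → S 0) (hφ0 : φ 0 = id) (ε : ℕ → ℝ) (hε0 : ε 0 = 0)
    {n : ℕ} (hn : 1 ≤ n) (hεn : 0 ≤ ε n) (x : S 0) (y : S n) :
    tdelta φ ε ⟨0, x⟩ ⟨n, y⟩ = dist x (φ n y) + ε n := by
  have h : ¬ (0 = n) := by omega
  simp [tdelta, h, hφ0, hε0, hεn]

/-- The points of `S 0` whose preimages under `φ n` all lie in `B` as soon as `n ≥ k`. -/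
def eventualCore {S : ℕ → Type*} (φ : ∀ n, S n → S 0) (B : Set (Σ n, S n)) (k : ℕ) :
    Set (S 0) :=
  {x | ∀ n, k ≤ n → ∀ y : S n, φ n y = x → (⟨n, y⟩ : Σ m, S m) ∈ B}

theorem monotone_eventualCore {S : ℕ → Type*} (φ : ∀ n, S n → S 0) (B : Set (Σ n, S n)) :
    Monotone (eventualCore φ B) :=
  fun _ _ hkl _ hx n hn => hx n (hkl.trans hn)

theorem subset_iUnion_interior_eventualCore {S : ℕ → Type*} [∀ n, MetricSpace (S n)]
    (φ : ∀ n, S n → S 0) (hφ0 : φ 0 = id) (ε : ℕ → ℝ) (hε0 : ε 0 = 0)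
    (hεpos : ∀ n, 1 ≤ n → 0 < ε n) (hεlim : Tendsto ε atTop (nhds 0)) (B : Set (Σ n, S n))
    (hB : ∀ x ∈ B, ∃ r : ℝ, 0 < r ∧ ∀ y : Σ n, S n, tdelta φ ε x y < r → y ∈ B) :
    {x : S 0 | (⟨0, x⟩ : Σ n, S n) ∈ B} ⊆ ⋃ k, interior (eventualCore φ B k) := by
  intro x hx
  obtain ⟨r, hr, hrB⟩ := hB _ hx
  obtain ⟨k, hk⟩ := eventually_atTop.1 (hεlim.eventually_lt_const (half_pos hr))
  refine Set.mem_iUnion.2 ⟨max k 1, mem_interior.2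
    ⟨Metric.ball x (r / 2), ?_, Metric.isOpen_ball, Metric.mem_ball_self (half_pos hr)⟩⟩
  rintro _ hz n hn y rfl
  have hn1 : 1 ≤ n := (le_max_right _ _).trans hn
  have hεn := hk n ((le_max_left _ _).trans hn)
  rw [Metric.mem_ball'] at hz
  apply hrB
  rw [tdelta_zero_of_one_le φ hφ0 ε hε0 hn1 (hεpos n hn1).le]
  linarith

theorem measure_le_liminf_preimage_of_isOpen {S : ℕ → Type*} [∀ n, MetricSpace (S n)]
    [∀ n, MeasurableSpace (S n)] [∀ n, BorelSpace (S n)]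
    (φ : ∀ n, S n → S 0) (hφ : ∀ n, Measurable (φ n))
    (μ : ∀ n, Measure (S n)) [∀ n, IsProbabilityMeasure (μ n)]
    (hweak : ∀ f : BoundedContinuousFunction (S 0) ℝ,
      Tendsto (fun n => ∫ x, f x ∂ ((μ n).map (φ n))) atTop (nhds (∫ x, f x ∂ (μ 0))))
    {U : Set (S 0)} (hU : IsOpen U) :
    μ 0 U ≤ atTop.liminf (fun n => μ n (φ n ⁻¹' U)) := by
  let ν : ℕ → ProbabilityMeasure (S 0) := fun n =>
    ⟨(μ n).map (φ n), Measure.isProbabilityMeasure_map (hφ n).aemeasurable⟩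
  have hν : Tendsto ν atTop (nhds ⟨μ 0, inferInstance⟩) :=
    ProbabilityMeasure.tendsto_iff_forall_integral_tendsto.2 hweak
  have h := ProbabilityMeasure.le_liminf_measure_open_of_tendsto hν hU
  have hmap : ∀ n, (ν n : Measure (S 0)) U = μ n (φ n ⁻¹' U) := fun n =>
    Measure.map_apply (hφ n) hU.measurableSet
  simp only [hmap] at h
  exact h

/-- if every `S n` is separable, every `φ n` (`n ≥ 1`) is continuous,
`μ n` is a Borel probability measure on `S n`, and the pushforwards `μ n ∘ φ n ⁻¹`
converge weakly to `μ 0`, then for every `δ`-open subset `B` of `T`,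
`liminf_n μ n (B ∩ S n) ≥ μ 0 (B ∩ S 0)`. -/
theorem tdelta_open_liminf
    (S : ℕ → Type*) [∀ n, MetricSpace (S n)]
    [∀ n, TopologicalSpace.SeparableSpace (S n)]
    [∀ n, MeasurableSpace (S n)] [∀ n, BorelSpace (S n)]
    (φ : ∀ n, S n → S 0) (hφ0 : φ 0 = id)
    (hφc : ∀ n, 1 ≤ n → Continuous (φ n))
    (ε : ℕ → ℝ) (hε0 : ε 0 = 0) (hεpos : ∀ n, 1 ≤ n → 0 < ε n)
    (hεanti : StrictAntiOn ε (Set.Ici 1))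
    (hεlim : Tendsto ε atTop (nhds 0))
    (μ : ∀ n, MeasureTheory.Measure (S n)) [∀ n, IsProbabilityMeasure (μ n)]
    (hweak : ∀ f : BoundedContinuousFunction (S 0) ℝ,
      Tendsto (fun n => ∫ x, f x ∂ ((μ n).map (φ n))) atTop
        (nhds (∫ x, f x ∂ (μ 0)))) :
    ∀ B : Set (Σ n, S n),
      (∀ x ∈ B, ∃ r : ℝ, 0 < r ∧ ∀ y : Σ n, S n, tdelta φ ε x y < r → y ∈ B) →
      μ 0 {x : S 0 | (⟨0, x⟩ : Σ n, S n) ∈ B} ≤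
        Filter.atTop.liminf (fun n => μ n {x : S n | (⟨n, x⟩ : Σ m, S m) ∈ B}) := by
  intro B hB
  have hφ : ∀ n, Measurable (φ n) := by
    intro n
    rcases Nat.eq_zero_or_pos n with rfl | hn
    · rw [hφ0]
      exact measurable_id
    · exact (hφc n hn).measurable
  refine (measure_mono (subset_iUnion_interior_eventualCore φ hφ0 ε hε0 hεpos hεlim B hB)).trans ?_
  have hmono : Monotone fun k => interior (eventualCore φ B k) :=
    fun _ _ hkl => interior_mono (monotone_eventualCore φ B hkl)
  rw [hmono.measure_iUnion]
  refine iSup_le fun k =>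
    (measure_le_liminf_preimage_of_isOpen φ hφ μ hweak isOpen_interior).trans ?_
  refine liminf_le_liminf ?_
  filter_upwards [eventually_ge_atTop k] with n hn
  exact measure_mono fun y hy => interior_subset hy n hn y rfl
end

section
/- Suppose every (S_n, ρ_n) is separable and complete and every φ_n (n ≥ 1) is Borel measurable. Then the metric space (T, δ) is complete if and only if for every n ≥ 1 the graph of φ_n, i.e. {(x, φ_n(x)) : x ∈ S_n}, is a closed subset of the product metric space S_n × S_0. -/
open Filter MeasureTheory Topology TopologicalSpace

section tdelta

variable {S : ℕ → Type*} [∀ n, MetricSpace (S n)] {φ : ∀ n, S n → S 0} {ε : ℕ → ℝ}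

theorem tdelta_mk_mk (n : ℕ) (a b : S n) :
    tdelta φ ε ⟨n, a⟩ ⟨n, b⟩ = dist (φ n a) (φ n b) + min (ε n) (dist a b) := by
  simp [tdelta, fiberDist]

theorem tdelta_of_ne {x y : Σ n, S n} (h : x.1 ≠ y.1) :
    tdelta φ ε x y = dist (φ x.1 x.2) (φ y.1 y.2) + max (ε x.1) (ε y.1) := by
  simp [tdelta, h]

theorem dist_le_tdelta (hε : ∀ n, 0 ≤ ε n) (x y : Σ n, S n) :
    dist (φ x.1 x.2) (φ y.1 y.2) ≤ tdelta φ ε x y := by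
  by_cases h : x.1 = y.1
  · obtain ⟨n, a⟩ := x
    obtain ⟨m, b⟩ := y
    obtain rfl : n = m := h
    rw [tdelta_mk_mk]
    exact le_add_of_nonneg_right (le_min (hε n) dist_nonneg)
  · rw [tdelta_of_ne h]
    exact le_add_of_nonneg_right (le_max_of_le_left (hε _))

theorem tdelta_nonneg (hε : ∀ n, 0 ≤ ε n) (x y : Σ n, S n) : 0 ≤ tdelta φ ε x y :=
  dist_nonneg.trans (dist_le_tdelta hε x y)

theorem fst_eq_of_tdelta_lt {x y : Σ n, S n} (h : tdelta φ ε x y < max (ε x.1) (ε y.1)) :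
    x.1 = y.1 := by
  by_contra hne
  rw [tdelta_of_ne hne] at h
  linarith [dist_nonneg (x := φ x.1 x.2) (y := φ y.1 y.2)]

theorem dist_lt_of_tdelta_lt {n : ℕ} {a b : S n} {r : ℝ}
    (h : tdelta φ ε ⟨n, a⟩ ⟨n, b⟩ < min (ε n) r) : dist a b < r := by
  rw [tdelta_mk_mk] at h
  have hd : 0 ≤ dist (φ n a) (φ n b) := dist_nonneg
  have hmin : min (ε n) (dist a b) < min (ε n) r := by linarith
  have hlt : dist a b < ε n := by
    by_contra! hle
    rw [min_eq_left hle] at hmin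
    exact absurd (min_le_left (ε n) r) (not_le.2 hmin)
  rw [min_eq_right hlt.le] at hmin
  exact hmin.trans_le (min_le_right _ _)

theorem tdelta_mk_zero_le (hφ0 : φ 0 = id) (hε0 : ε 0 = 0) (hε : ∀ n, 0 ≤ ε n)
    (x : Σ n, S n) (y : S 0) :
    tdelta φ ε x ⟨0, y⟩ ≤ dist (φ x.1 x.2) y + ε x.1 := by
  by_cases h : x.1 = 0
  · obtain ⟨n, a⟩ := x
    obtain rfl : n = 0 := h
    rw [tdelta_mk_mk]
    simp [hε0, hφ0]
  · rw [tdelta_of_ne h]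
    simp [hε0, hφ0, hε]

theorem isClosed_graph_of_tdelta_complete {n : ℕ} (hn : 0 < ε n) (hε : ∀ n, 0 ≤ ε n)
    (hc : ∀ x : ℕ → Σ n, S n,
      (∀ r : ℝ, 0 < r → ∃ N, ∀ m ≥ N, ∀ l ≥ N, tdelta φ ε (x m) (x l) < r) →
      ∃ x0 : Σ n, S n, Tendsto (fun m => tdelta φ ε (x m) x0) atTop (nhds 0)) :
    IsClosed {p : S n × S 0 | p.2 = φ n p.1} := by
  refine IsSeqClosed.isClosed fun u p hu hup => ?_
  have hu1 : Tendsto (fun k => (u k).1) atTop (𝓝 p.1) := (continuous_fst.tendsto p).comp hup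
  have hu2 : Tendsto (fun k => φ n (u k).1) atTop (𝓝 p.2) :=
    ((continuous_snd.tendsto p).comp hup).congr hu
  obtain ⟨x, hx⟩ := hc (fun k => ⟨n, (u k).1⟩) fun r hr => by
    obtain ⟨N₁, hN₁⟩ := Metric.cauchySeq_iff.1 hu1.cauchySeq (r / 2) (half_pos hr)
    obtain ⟨N₂, hN₂⟩ := Metric.cauchySeq_iff.1 hu2.cauchySeq (r / 2) (half_pos hr)
    refine ⟨max N₁ N₂, fun m hm l hl => ?_⟩
    rw [tdelta_mk_mk]
    have h₁ := hN₁ m (le_of_max_le_left hm) l (le_of_max_le_left hl)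
    have h₂ := hN₂ m (le_of_max_le_right hm) l (le_of_max_le_right hl)
    linarith [min_le_right (ε n) (dist (u m).1 (u l).1)]
  obtain ⟨k, hk⟩ := (hx.eventually_lt_const hn).exists
  obtain ⟨m, a⟩ := x
  obtain rfl : n = m := fst_eq_of_tdelta_lt (hk.trans_le (le_max_left _ _))
  have ha : Tendsto (fun k => (u k).1) atTop (𝓝 a) := by
    refine Metric.tendsto_nhds.2 fun r hr => ?_
    filter_upwards [hx.eventually_lt_const (lt_min hn hr)] with k hk
    exact dist_lt_of_tdelta_lt hk
  have hφa : Tendsto (fun k => φ n (u k).1) atTop (𝓝 (φ n a)) :=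
    tendsto_iff_dist_tendsto_zero.2 <|
      squeeze_zero (fun _ => dist_nonneg)
        (fun k => dist_le_tdelta (φ := φ) hε ⟨n, (u k).1⟩ ⟨n, a⟩) hx
  change p.2 = φ n p.1
  rw [tendsto_nhds_unique hu1 ha, tendsto_nhds_unique hu2 hφa]

theorem exists_tendsto_tdelta_of_fiber {n : ℕ} [CompleteSpace (S n)] (hn : 0 < ε n)
    (hε : ∀ n, 0 ≤ ε n) (hcl : IsClosed {p : S n × S 0 | p.2 = φ n p.1}) {z : ℕ → S n}
    (hz : ∀ r : ℝ, 0 < r → ∃ N, ∀ m ≥ N, ∀ l ≥ N, tdelta φ ε ⟨n, z m⟩ ⟨n, z l⟩ < r)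
    {y : S 0} (hy : Tendsto (fun k => φ n (z k)) atTop (𝓝 y)) :
    ∃ x : Σ n, S n, Tendsto (fun k => tdelta φ ε ⟨n, z k⟩ x) atTop (𝓝 0) := by
  have hzc : CauchySeq z := by
    refine Metric.cauchySeq_iff.2 fun r hr => ?_
    obtain ⟨N, hN⟩ := hz _ (lt_min hn hr)
    exact ⟨N, fun m hm l hl => dist_lt_of_tdelta_lt (hN m hm l hl)⟩
  obtain ⟨a, ha⟩ := cauchySeq_tendsto_of_complete hzc
  have hya : y = φ n a :=
    hcl.mem_of_tendsto (ha.prodMk_nhds hy) (Eventually.of_forall fun _ => rfl)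
  refine ⟨⟨n, a⟩, squeeze_zero (fun _ => tdelta_nonneg hε _ _)
    (g := fun k => dist (φ n (z k)) (φ n a) + dist (z k) a) (fun k => ?_) ?_⟩
  · rw [tdelta_mk_mk]
    gcongr
    exact min_le_right _ _
  · rw [hya] at hy
    simpa using (tendsto_iff_dist_tendsto_zero.1 hy).add (tendsto_iff_dist_tendsto_zero.1 ha)

/-- If a sequence of indices eventually leaves every positive index, then `ε` tends to zero
along it. -/
theorem tendsto_comp_of_eventually_ne (hε0 : ε 0 = 0) (hε : ∀ n, 0 ≤ ε n)
    (hεlim : Tendsto ε atTop (𝓝 0)) {s : ℕ → ℕ}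
    (hs : ∀ n, 1 ≤ n → ∀ᶠ m in atTop, s m ≠ n) : Tendsto (fun m => ε (s m)) atTop (𝓝 0) := by
  refine tendsto_order.2 ⟨fun r hr => Eventually.of_forall fun m => hr.trans_le (hε _),
    fun r hr => ?_⟩
  obtain ⟨K, hK⟩ := eventually_atTop.1 (hεlim.eventually_lt_const hr)
  have hleave : ∀ᶠ m in atTop, ∀ n ∈ Finset.Ico 1 K, s m ≠ n :=
    (Finset.eventually_all _).2 fun n hn => hs n (Finset.mem_Ico.1 hn).1
  filter_upwards [hleave] with m hm
  rcases Nat.eq_zero_or_pos (s m) with h | h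
  · rwa [h, hε0]
  · refine hK _ (le_of_not_gt fun hlt => hm (s m) (Finset.mem_Ico.2 ⟨h, hlt⟩) rfl)

end tdelta

/-- Theorem 2.2: if every `(S n, ρ n)` is separable and complete and
every `φ n` (`n ≥ 1`) is Borel measurable, then `(T, δ)` is complete (every
`δ`-Cauchy sequence `δ`-converges) iff the graph of `φ n` is closed in
`S n × S 0` for every `n ≥ 1`. -/
theorem tdelta_complete_iff_graphs_closed
    (S : ℕ → Type*) [∀ n, MetricSpace (S n)]
    [∀ n, TopologicalSpace.SeparableSpace (S n)]
    [∀ n, CompleteSpace (S n)]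
    [∀ n, MeasurableSpace (S n)] [∀ n, BorelSpace (S n)]
    (φ : ∀ n, S n → S 0) (hφ0 : φ 0 = id)
    (hφm : ∀ n, 1 ≤ n → Measurable (φ n))
    (ε : ℕ → ℝ) (hε0 : ε 0 = 0) (hεpos : ∀ n, 1 ≤ n → 0 < ε n)
    (hεanti : StrictAntiOn ε (Set.Ici 1))
    (hεlim : Tendsto ε atTop (nhds 0)) :
    (∀ x : ℕ → Σ n, S n,
        (∀ r : ℝ, 0 < r → ∃ N, ∀ m ≥ N, ∀ l ≥ N, tdelta φ ε (x m) (x l) < r) →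
        ∃ x0 : Σ n, S n, Tendsto (fun m => tdelta φ ε (x m) x0) atTop (nhds 0)) ↔
      ∀ n, 1 ≤ n → IsClosed {p : S n × S 0 | p.2 = φ n p.1} := by
  have hε : ∀ n, 0 ≤ ε n := fun n => by
    rcases Nat.eq_zero_or_pos n with rfl | h
    exacts [hε0.ge, (hεpos n h).le]
  refine ⟨fun hc n hn => isClosed_graph_of_tdelta_complete (hεpos n hn) hε hc,
    fun hcl x hx => ?_⟩
  have hφx : CauchySeq fun m => φ (x m).1 (x m).2 := by
    refine Metric.cauchySeq_iff.2 fun r hr => ?_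
    obtain ⟨N, hN⟩ := hx r hr
    exact ⟨N, fun m hm l hl => (dist_le_tdelta hε _ _).trans_lt (hN m hm l hl)⟩
  obtain ⟨y, hy⟩ := cauchySeq_tendsto_of_complete hφx
  by_cases hs : ∀ n, 1 ≤ n → ∀ᶠ m in atTop, (x m).1 ≠ n
  · refine ⟨⟨0, y⟩, squeeze_zero (fun _ => tdelta_nonneg hε _ _)
      (fun m => tdelta_mk_zero_le hφ0 hε0 hε (x m) y) ?_⟩
    simpa using (tendsto_iff_dist_tendsto_zero.1 hy).add
      (tendsto_comp_of_eventually_ne hε0 hε hεlim hs)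
  · push Not at hs
    obtain ⟨n, hn, hfreq⟩ := hs
    obtain ⟨N, hN⟩ := hx _ (hεpos n hn)
    obtain ⟨l, hl, hln⟩ := frequently_atTop.1 hfreq N
    have hfiber : ∀ k, ∃ z : S n, x (k + N) = ⟨n, z⟩ := fun k => by
      have hlt := hN (k + N) (Nat.le_add_left _ _) l hl
      have hfst : (x (k + N)).1 = n :=
        (fst_eq_of_tdelta_lt (hlt.trans_le (hln ▸ le_max_right _ _))).trans hln
      generalize x (k + N) = w at hfst
      obtain ⟨i, z⟩ := w
      obtain rfl : i = n := hfst
      exact ⟨z, rfl⟩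
    choose z hz using hfiber
    have hyz : Tendsto (fun k => φ n (z k)) atTop (𝓝 y) := by
      refine ((tendsto_add_atTop_iff_nat N).2 hy).congr fun k => ?_
      rw [hz]
    obtain ⟨x₀, hx₀⟩ := exists_tendsto_tdelta_of_fiber (hεpos n hn) hε (hcl n hn) (z := z)
      (fun r hr => by
        obtain ⟨M, hM⟩ := hx r hr
        refine ⟨M, fun m hm k hk => ?_⟩
        rw [← hz, ← hz]
        exact hM _ (by omega) _ (by omega)) hyz
    refine ⟨x₀, (tendsto_add_atTop_iff_nat N).1 (hx₀.congr fun k => ?_)⟩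
    rw [hz]
end

section
/- Suppose every (S_n, ρ_n) is a Polish space (separable and completely metrizable). Then the topological space (T, δ) is Polish if and only if for every n ≥ 1 the graph of φ_n, i.e. {(x, φ_n(x)) : x ∈ S_n}, is a G_δ subset of the product space S_n × S_0 (an intersection of at most countably many open sets). -/
open Filter MeasureTheory Topology TopologicalSpace

/-- A space that admits a proper injective map to a Polish space is Polish. -/
theorem IsProperMap.polishSpace_of_injective {X Y : Type*} [TopologicalSpace X]
    [TopologicalSpace Y] [PolishSpace Y] {f : X → Y} (hf : IsProperMap f)
    (hinj : Function.Injective f) : PolishSpace X :=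
  (IsClosedEmbedding.of_continuous_injective_isClosedMap hf.continuous hinj
    hf.isClosedMap).polishSpace

/-- A `Gδ` subset of a Polish space is Polish. -/
theorem IsGδ.polishSpace {X : Type*} [TopologicalSpace X] [PolishSpace X] {s : Set X}
    (hs : IsGδ s) : PolishSpace s := by
  obtain ⟨U, hU, rfl⟩ := isGδ_iff_eq_iInter_nat.1 hs
  have := fun n => (hU n).polishSpace
  let F : (⋂ n, U n : Set X) → ∀ n, U n := fun x n => ⟨x, Set.mem_iInter.1 x.2 n⟩
  refine IsProperMap.polishSpace_of_injective (f := F) ?_ fun x y h =>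
    Subtype.ext (congrArg Subtype.val (congrFun h 0) :)
  refine isProperMap_iff_ultrafilter_of_t2.2 ⟨by fun_prop, fun 𝒰 y hy => ?_⟩
  have hval : ∀ n, Tendsto Subtype.val (𝒰 : Filter (⋂ n, U n : Set X)) (𝓝 (y n : X)) :=
    fun n => (continuous_subtype_val.tendsto _).comp (tendsto_pi_nhds.1 hy n)
  refine ⟨⟨y 0, Set.mem_iInter.2 fun n => ?_⟩, ?_⟩
  · rw [tendsto_nhds_unique (hval 0) (hval n)]
    exact (y n).2
  · rw [nhds_induced]
    exact tendsto_iff_comap.1 (hval 0)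

/-- The range of an embedding of a completely metrizable space into a metrizable space
is a `Gδ` set. -/
theorem Topology.IsEmbedding.isGδ_range {X Y : Type*} [TopologicalSpace X]
    [IsCompletelyMetrizableSpace X] [TopologicalSpace Y] [MetrizableSpace Y] {e : X → Y}
    (he : IsEmbedding e) : IsGδ (Set.range e) := by
  let := upgradeIsCompletelyMetrizable X
  let := metrizableSpaceMetric Y
  let W : ℕ → Set Y := fun k =>
    ⋃₀ {U | IsOpen U ∧ ∀ a b, e a ∈ U → e b ∈ U → dist a b < 1 / ((k : ℝ) + 1)}
  have hW : ∀ k, IsOpen (W k) := fun k => isOpen_sUnion fun U hU => hU.1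
  suffices h : Set.range e = closure (Set.range e) ∩ ⋂ k, W k by
    rw [h]
    exact isClosed_closure.isGδ.inter (.iInter_of_isOpen hW)
  refine Set.Subset.antisymm (Set.subset_inter subset_closure ?_) ?_
  · rintro _ ⟨a, rfl⟩
    refine Set.mem_iInter.2 fun k => ?_
    have hk : (0 : ℝ) < 1 / ((k : ℝ) + 1) := Nat.one_div_pos_of_nat
    obtain ⟨U, hU, hUa⟩ := he.isOpen_iff.1
      (Metric.isOpen_ball (x := a) (ε := 1 / ((k : ℝ) + 1) / 2))
    have hmem : ∀ b, e b ∈ U ↔ dist b a < 1 / ((k : ℝ) + 1) / 2 := fun b => by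
      rw [← Set.mem_preimage, hUa, Metric.mem_ball]
    refine ⟨U, ⟨hU, fun b c hb hc => ?_⟩, (hmem a).2 (by simpa using hk)⟩
    have := dist_triangle_right b c a
    linarith [(hmem b).1 hb, (hmem c).1 hc]
  · rintro y ⟨hy, hyW⟩
    have : (comap e (𝓝 y)).NeBot := 
      comap_neBot_iff_frequently.2 (mem_closure_iff_frequently.1 hy)
    have hc : Cauchy (comap e (𝓝 y)) := by
      refine Metric.cauchy_iff.2 ⟨this, fun r hr => ?_⟩
      obtain ⟨k, hk⟩ := exists_nat_one_div_lt hr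
      obtain ⟨U, ⟨hU, hd⟩, hyU⟩ := Set.mem_iInter.1 hyW k
      exact ⟨e ⁻¹' U, preimage_mem_comap (hU.mem_nhds hyU),
        fun a ha b hb => (hd a b ha hb).trans hk⟩
    obtain ⟨a, ha⟩ := CompleteSpace.complete hc
    exact ⟨a, tendsto_nhds_unique ((he.continuous.tendsto a).mono_left ha) tendsto_comap⟩

/-- Let `A n` be clopen Polish subspaces of `T` and let `f` be a continuous map from `T` to a
Polish space, injective off `⋃ n, A n`. If every ultrafilter that avoids each `A n` and has
convergent image under `f` converges, then `T` is Polish. -/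
theorem polishSpace_of_isClopen_pieces {T P : Type*} [TopologicalSpace T] [TopologicalSpace P]
    [PolishSpace P] {f : T → P} (hf : Continuous f) {A : ℕ → Set T}
    (hA : ∀ n, IsClopen (A n)) (hpol : ∀ n, PolishSpace (A n))
    (hinj : Set.InjOn f (⋃ n, A n)ᶜ)
    (hlim : ∀ (𝒰 : Ultrafilter T) (p : P), Tendsto f 𝒰 (𝓝 p) → (∀ n, (A n)ᶜ ∈ 𝒰) →
      ∃ x, (𝒰 : Filter T) ≤ 𝓝 x) : PolishSpace T := by
  classical
  let c : ∀ n, T → A n ⊕ Unit := fun n x => if h : x ∈ A n then .inl ⟨x, h⟩ else .inr ()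
  have hcin : ∀ n x (h : x ∈ A n), c n x = .inl ⟨x, h⟩ := fun n x h => dif_pos h
  have hcout : ∀ n x, x ∉ A n → c n x = .inr () := fun n x h => dif_neg h
  have hc : ∀ n, Continuous (c n) := fun n => by
    refine continuous_iff_continuousAt.2 fun x => ?_
    by_cases hx : x ∈ A n
    · refine ContinuousOn.continuousAt (s := A n) ?_ ((hA n).isOpen.mem_nhds hx)
      rw [continuousOn_iff_continuous_domRestrict]
      exact continuous_inl.congr fun y => (hcin n y y.2).symm
    · refine ContinuousAt.congr (f := fun _ => Sum.inr ()) continuousAt_const ?_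
      filter_upwards [(hA n).compl.isOpen.mem_nhds hx] with y hy using (hcout n y hy).symm
  have (n : ℕ) : PolishSpace (A n ⊕ Unit) :=
    have : IsCompletelyMetrizableSpace (A n ⊕ Unit) := inferInstance
    inferInstance
  refine IsProperMap.polishSpace_of_injective (f := fun x => (f x, fun n => c n x)) ?_ ?_
  · refine isProperMap_iff_ultrafilter.2 ⟨by fun_prop, fun 𝒰 y hy => ?_⟩
    suffices h : ∃ x, (𝒰 : Filter T) ≤ 𝓝 x by
      obtain ⟨x, hx⟩ := h
      have hF : Continuous fun x => (f x, fun n => c n x) := by fun_prop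
      exact ⟨x, tendsto_nhds_unique ((hF.tendsto x).mono_left hx) hy, hx⟩
    have hy1 : Tendsto f 𝒰 (𝓝 y.1) := (continuous_fst.tendsto y).comp hy
    have hy2 : ∀ n, Tendsto (c n) 𝒰 (𝓝 (y.2 n)) :=
      tendsto_pi_nhds.1 ((continuous_snd.tendsto y).comp hy)
    by_cases h : ∃ n a, y.2 n = .inl a
    · obtain ⟨n, a, ha⟩ := h
      refine ⟨a, fun V hV => ?_⟩
      have hn := hy2 n
      rw [ha] at hn
      have hV' : Sum.inl '' (Subtype.val ⁻¹' V : Set (A n)) ∈ 𝓝 (Sum.inl a : A n ⊕ Unit) :=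
        IsOpenEmbedding.inl.image_mem_nhds.2 (continuous_subtype_val.continuousAt hV)
      filter_upwards [hn hV'] with x hx
      obtain ⟨b, hb, hbx⟩ := hx
      by_cases hxA : x ∈ A n
      · rw [hcin n x hxA, Sum.inl.injEq] at hbx
        rwa [hbx] at hb
      · simp [hcout n x hxA] at hbx
    · refine hlim 𝒰 y.1 hy1 fun n => ?_
      obtain ⟨u, hu⟩ : ∃ u, y.2 n = .inr u := by
        rcases hyn : y.2 n with a | u
        exacts [(h ⟨n, a, hyn⟩).elim, ⟨u, rfl⟩]
      have hn := hy2 n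
      rw [hu] at hn
      filter_upwards [hn (isOpen_range_inr.mem_nhds ⟨u, rfl⟩)] with x hx hxA
      simp [hcin n x hxA] at hx
  · intro x y hxy
    obtain ⟨hfxy, hcxy⟩ := Prod.ext_iff.1 hxy
    have hmem : ∀ n x y, c n x = c n y → x ∈ A n → x = y := fun n x y h hx => by
      by_cases hy : y ∈ A n
      · rw [hcin n x hx, hcin n y hy, Sum.inl.injEq] at h
        exact congrArg Subtype.val h
      · simp [hcin n x hx, hcout n y hy] at h
    by_cases hx : x ∈ ⋃ n, A n
    · obtain ⟨n, hn⟩ := Set.mem_iUnion.1 hx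
      exact hmem n x y (congrFun hcxy n) hn
    by_cases hy : y ∈ ⋃ n, A n
    · obtain ⟨n, hn⟩ := Set.mem_iUnion.1 hy
      exact (hmem n y x (congrFun hcxy n).symm hn).symm
    exact hinj hx hy hfxy

/-- If the distance on `X` pulls back along `j` as `dist (g a) (g b) + min r (dist a b)`, then
`X` restricted to the range of `j` is the graph of `g`. -/
theorem isEmbedding_graph_of_dist {X Y Z : Type*} [MetricSpace X] [MetricSpace Y]
    [MetricSpace Z] {g : Y → Z} {j : Y → X} {r : ℝ} (hr : 0 < r)
    (h : ∀ a b, dist (j a) (j b) = dist (g a) (g b) + min r (dist a b)) :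
    IsEmbedding fun p : {p : Y × Z | p.2 = g p.1} => j p.1.1 := by
  have hdist : ∀ p q : {p : Y × Z | p.2 = g p.1},
      dist (j p.1.1) (j q.1.1) = dist p.1.2 q.1.2 + min r (dist p.1.1 q.1.1) := fun p q => by
    rw [h, p.2, q.2]
  refine (Metric.isUniformEmbedding_iff'.2 ⟨fun t ht => ⟨t / 2, half_pos ht, ?_⟩,
    fun t ht => ⟨min t r, lt_min ht hr, ?_⟩⟩).isEmbedding
  · intro p q hpq
    obtain ⟨h1, h2⟩ := max_lt_iff.1 (Prod.dist_eq (x := p.1) (y := q.1) ▸ hpq)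
    rw [hdist]
    linarith [min_le_right r (dist p.1.1 q.1.1)]
  · intro p q hpq
    rw [hdist] at hpq
    obtain ⟨h1, h2⟩ := lt_min_iff.1 hpq
    have h0 : 0 ≤ dist p.1.2 q.1.2 := dist_nonneg
    have h3 : min r (dist p.1.1 q.1.1) < r := by linarith
    have h4 : dist p.1.1 q.1.1 < r := by simpa using h3
    rw [min_eq_right h4.le] at h1
    have h5 : 0 ≤ dist p.1.1 q.1.1 := dist_nonneg
    rw [Subtype.dist_eq, Prod.dist_eq]
    exact max_lt (by linarith) (by linarith)

/-- A metric space `T` covered by pieces `j n : S n → T`, with distances given by the formula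
defining `tdelta`, is Polish iff the graphs of the maps `φ n` are `Gδ` for `n ≥ 1`. -/
theorem polishSpace_iff_isGδ_graph_of_dist {S : ℕ → Type*} [∀ n, MetricSpace (S n)]
    [∀ n, PolishSpace (S n)] {φ : ∀ n, S n → S 0} (hφ0 : φ 0 = id)
    {ε : ℕ → ℝ} (hε0 : ε 0 = 0) (hεpos : ∀ n, 1 ≤ n → 0 < ε n)
    (hεlim : Tendsto ε atTop (𝓝 0)) {T : Type*} [MetricSpace T] (j : ∀ n, S n → T)
    (hj : ∀ x, ∃ n a, j n a = x) (f : T → S 0) (hf : ∀ n a, f (j n a) = φ n a)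
    (hsame : ∀ n a b, dist (j n a) (j n b) = dist (φ n a) (φ n b) + min (ε n) (dist a b))
    (hdiff : ∀ m n a b, m ≠ n →
      dist (j m a) (j n b) = dist (φ m a) (φ n b) + max (ε m) (ε n)) :
    PolishSpace T ↔ ∀ n, 1 ≤ n → IsGδ {p : S n × S 0 | p.2 = φ n p.1} := by
  have hεnn : ∀ n, 0 ≤ ε n := fun n => by
    rcases Nat.eq_zero_or_pos n with rfl | hn
    exacts [hε0.ge, (hεpos n hn).le]
  have hfar : ∀ m n a b, m ≠ n → ε n ≤ dist (j m a) (j n b) := fun m n a b hmn => by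
    rw [hdiff m n a b hmn]
    exact (le_max_right _ _).trans (le_add_of_nonneg_left dist_nonneg)
  have hclopen : ∀ n, 1 ≤ n → IsClopen (Set.range (j n)) := fun n hn => by
    refine ⟨⟨Metric.isOpen_iff.2 fun x hx => ⟨ε n, hεpos n hn, ?_⟩⟩,
      Metric.isOpen_iff.2 fun x hx => ⟨ε n, hεpos n hn, ?_⟩⟩
    · obtain ⟨m, a, rfl⟩ := hj x
      rintro _ hy ⟨b, rfl⟩
      have hmn : m ≠ n := by
        rintro rfl
        exact hx ⟨a, rfl⟩
      exact (hfar m n a b hmn).not_gt (Metric.mem_ball'.1 hy)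
    · obtain ⟨a, rfl⟩ := hx
      intro y hy
      obtain ⟨m, b, rfl⟩ := hj y
      by_cases hmn : m = n
      · subst hmn
        exact ⟨b, rfl⟩
      · exact ((hfar m n b a hmn).not_gt hy).elim
  have hemb := fun n (hn : 1 ≤ n) => isEmbedding_graph_of_dist (hεpos n hn) (hsame n)
  have hrange : ∀ n, Set.range (fun p : {p : S n × S 0 | p.2 = φ n p.1} => j n p.1.1) =
      Set.range (j n) := fun n => Set.Subset.antisymm
    (Set.range_subset_iff.2 fun p => ⟨_, rfl⟩)
    (Set.range_subset_iff.2 fun a => ⟨⟨(a, φ n a), rfl⟩, rfl⟩)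
  constructor
  · intro hT n hn
    have hp : PolishSpace {p : S n × S 0 | p.2 = φ n p.1} :=
      IsClosedEmbedding.polishSpace ⟨hemb n hn, (hrange n).symm ▸ (hclopen n hn).isClosed⟩
    have := IsEmbedding.subtypeVal.isGδ_range (e := fun p : {p : S n × S 0 | p.2 = φ n p.1} => p.1)
    rwa [Subtype.range_val] at this
  · intro hG
    have hlip : ∀ x y, dist (f x) (f y) ≤ dist x y := fun x y => by
      obtain ⟨m, a, rfl⟩ := hj x
      obtain ⟨n, b, rfl⟩ := hj y
      rw [hf, hf]
      by_cases hmn : m = n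
      · subst hmn
        rw [hsame]
        exact le_add_of_nonneg_right (le_min (hεnn m) dist_nonneg)
      · rw [hdiff m n a b hmn]
        exact le_add_of_nonneg_right ((hεnn m).trans (le_max_left _ _))
    have hzero : ∀ x, (∀ n, x ∉ Set.range (j (n + 1))) → ∃ a, j 0 a = x := fun x hx => by
      obtain ⟨_ | n, a, rfl⟩ := hj x
      exacts [⟨a, rfl⟩, (hx n ⟨a, rfl⟩).elim]
    refine polishSpace_of_isClopen_pieces (f := f) (A := fun n => Set.range (j (n + 1)))
      (LipschitzWith.mk_one hlip).continuous (fun n => hclopen _ n.succ_pos) (fun n => ?_) ?_ ?_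
    · have := (hG (n + 1) n.succ_pos).polishSpace
      rw [← hrange]
      exact (hemb (n + 1) n.succ_pos).toHomeomorph.symm.isClosedEmbedding.polishSpace
    · intro x hx y hy hxy
      obtain ⟨a, rfl⟩ := hzero x fun n hn => hx (Set.mem_iUnion.2 ⟨n, hn⟩)
      obtain ⟨b, rfl⟩ := hzero y fun n hn => hy (Set.mem_iUnion.2 ⟨n, hn⟩)
      rw [hf, hf, hφ0] at hxy
      exact congrArg (j 0) hxy
    · intro 𝒰 p hp hout
      refine ⟨j 0 p, Metric.nhds_basis_ball.ge_iff.2 fun r hr => ?_⟩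
      obtain ⟨N, hN⟩ := eventually_atTop.1 (hεlim.eventually_lt_const (half_pos hr))
      have hfin : ∀ᶠ x in (𝒰 : Filter T), ∀ n ∈ Set.Iio N, x ∉ Set.range (j (n + 1)) :=
        (Set.finite_Iio N).eventually_all.2 fun n _ => hout n
      filter_upwards [hp (Metric.ball_mem_nhds p (half_pos hr)), hfin] with x hxp hx
      obtain ⟨m, a, rfl⟩ := hj x
      have hxp' : dist (φ m a) p < r / 2 := hf m a ▸ hxp
      rw [Metric.mem_ball]
      rcases m with _ | m
      · rw [hsame, hφ0, hε0, min_eq_left dist_nonneg, add_zero]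
        rw [hφ0] at hxp'
        exact hxp'.trans (half_lt_self hr)
      · have hm : N ≤ m := not_lt.1 fun hm => hx m hm ⟨a, rfl⟩
        rw [hdiff _ _ _ _ m.succ_ne_zero, hφ0, hε0, max_eq_left (hεnn _), id]
        linarith [hN (m + 1) (by omega)]

/-- Theorem 2.3: if every `S n` is Polish, then `(T, δ)` is Polish iff
the graph of `φ n` is a `Gδ` subset of `S n × S 0` for every `n ≥ 1`.
The metric space structure on `T` induced by `δ` is supplied as a hypothesis `mT`
whose distance function is required to coincide with `δ`. -/
theorem tdelta_polish_iff_graphs_Gdelta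
    (S : ℕ → Type*) [∀ n, MetricSpace (S n)] [∀ n, PolishSpace (S n)]
    (φ : ∀ n, S n → S 0) (hφ0 : φ 0 = id)
    (ε : ℕ → ℝ) (hε0 : ε 0 = 0) (hεpos : ∀ n, 1 ≤ n → 0 < ε n)
    (hεanti : StrictAntiOn ε (Set.Ici 1))
    (hεlim : Tendsto ε atTop (nhds 0))
    (mT : MetricSpace (Σ n, S n))
    (hmT : ∀ x y : Σ n, S n, mT.toDist.dist x y = tdelta φ ε x y) :
    @PolishSpace (Σ n, S n) mT.toUniformSpace.toTopologicalSpace ↔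
      ∀ n, 1 ≤ n → IsGδ {p : S n × S 0 | p.2 = φ n p.1} := by
  refine @polishSpace_iff_isGδ_graph_of_dist S _ _ φ hφ0 ε hε0 hεpos hεlim _ mT
    (fun n a => ⟨n, a⟩) (fun x => ⟨x.1, x.2, rfl⟩) (fun x => φ x.1 x.2) (fun _ _ => rfl)
    (fun n a b => ?_) (fun m n a b hmn => ?_)
  · rw [hmT]
    simp [tdelta, fiberDist]
  · rw [hmT]
    simp [tdelta, hmn]
end
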